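/- arXiv:1604.06172 — 5 statements merged into one kernel-verified Lean document; each statement's English description precedes it below -/
import Mathlib

section
/- Let p be a prime, let X be a finite simple graph with adjacency matrix A, regarded as a matrix over the field with p elements, and let Y be a clique of X. If p divides |Y| - 1, then |Y| ≤ rank_p(A) + 1, where rank_p(A) denotes the rank of A over the field with p elements. -/
theorem SimpleGraph.adjMatrix_submatrix_of_isClique {R V : Type*} [Ring R] [DecidableEq V]
    (X : SimpleGraph V) [DecidableRel X.Adj] {Y : Finset V} (hY : X.IsClique (Y : Set V)) :
    (X.adjMatrix R).submatrix ((↑) : Y → V) ((↑) : Y → V) = Matrix.vecMulVec 1 1 - 1 := by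
  ext i j
  by_cases h : i = j
  · simp [h]
  · simp [h, hY i.2 j.2 (Subtype.coe_injective.ne h)]

/-- Lemma 3(a): if `Y` is a clique of a finite simple graph `X` with adjacency matrix `A`
over `ZMod p`, and `p` divides `|Y| - 1`, then `|Y| ≤ rank_p A + 1`. -/
theorem clique_le_prank_add_one (p : ℕ) (hp : p.Prime)
    {V : Type} [Fintype V] [DecidableEq V]
    (X : SimpleGraph V) [DecidableRel X.Adj]
    (Y : Finset V) (hY : X.IsClique (Y : Set V))
    (hdvd : (p : ℤ) ∣ (Y.card : ℤ) - 1) :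
    Y.card ≤ (X.adjMatrix (ZMod p)).rank + 1 := by
  have : Fact p.Prime := ⟨hp⟩
  have hker : Disjoint
      (LinearMap.ker ((X.adjMatrix (ZMod p)).submatrix ((↑) : Y → V) ((↑) : Y → V)).mulVecLin)
      (LinearMap.ker (Matrix.vecMulVec (1 : Y → ZMod p) (1 : Y → ZMod p)).mulVecLin) := by
    rw [Submodule.disjoint_def]
    intro v hA hJ
    rw [LinearMap.mem_ker, Matrix.mulVecLin_apply] at hA hJ
    rwa [SimpleGraph.adjMatrix_submatrix_of_isClique X hY, Matrix.sub_mulVec, hJ, zero_sub,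
      Matrix.one_mulVec, neg_eq_zero] at hA
  have hsum := Submodule.finrank_add_finrank_le_of_disjoint hker
  have hA := LinearMap.finrank_range_add_finrank_ker
    ((X.adjMatrix (ZMod p)).submatrix ((↑) : Y → V) ((↑) : Y → V)).mulVecLin
  have hJ := LinearMap.finrank_range_add_finrank_ker
    (Matrix.vecMulVec (1 : Y → ZMod p) (1 : Y → ZMod p)).mulVecLin
  have hJ_rank := Matrix.rank_vecMulVec_le (1 : Y → ZMod p) (1 : Y → ZMod p)
  have hA_rank := (X.adjMatrix (ZMod p)).rank_submatrix_le ((↑) : Y → V) ((↑) : Y → V)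
  simp only [Module.finrank_fintype_fun_eq_card, Fintype.card_coe] at hsum hA hJ
  unfold Matrix.rank at hJ_rank hA_rank ⊢
  omega
end

section
/- Let p be a prime, let X be a finite simple graph with adjacency matrix A, regarded as a matrix over the field with p elements, and let Y be a clique of X. If p does not divide |Y| - 1, then |Y| ≤ rank_p(A), where rank_p(A) denotes the rank of A over the field with p elements. -/
/-- The adjacency matrix of a complete graph on `n` vertices is invertible over a field in which
`n ≠ 1`. -/
theorem SimpleGraph.isUnit_adjMatrix_top {α K : Type*} [Fintype α] [DecidableEq α] [Field K]
    (h : (Fintype.card α : K) ≠ 1) : IsUnit ((⊤ : SimpleGraph α).adjMatrix K) := by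
  have hdec : (⊤ : SimpleGraph α).adjMatrix K =
      -(1 + Matrix.replicateCol Unit (fun _ : α => (-1 : K)) *
        Matrix.replicateRow Unit (fun _ : α => (1 : K))) := by
    ext i j
    by_cases hij : i = j <;> simp [Matrix.mul_apply, hij]
  rw [hdec, IsUnit.neg_iff, Matrix.isUnit_iff_isUnit_det,
    Matrix.det_one_add_replicateCol_mul_replicateRow, isUnit_iff_ne_zero]
  simpa [dotProduct, ← sub_eq_add_neg, sub_eq_zero] using h.symm

/-- Lemma 3(b): if `Y` is a clique of a finite simple graph `X` with adjacency matrix `A`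
over `ZMod p`, and `p` does not divide `|Y| - 1`, then `|Y| ≤ rank_p A`. -/
theorem clique_le_prank (p : ℕ) (hp : p.Prime)
    {V : Type} [Fintype V] [DecidableEq V]
    (X : SimpleGraph V) [DecidableRel X.Adj]
    (Y : Finset V) (hY : X.IsClique (Y : Set V))
    (hndvd : ¬ ((p : ℤ) ∣ (Y.card : ℤ) - 1)) :
    Y.card ≤ (X.adjMatrix (ZMod p)).rank := by
  have := Fact.mk hp
  have hcard : (Fintype.card Y : ZMod p) ≠ 1 := by
    rw [← ZMod.intCast_zmod_eq_zero_iff_dvd] at hndvd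
    simpa [sub_eq_zero] using hndvd
  have hsub : (X.adjMatrix (ZMod p)).submatrix (Subtype.val : Y → V) Subtype.val =
      (⊤ : SimpleGraph Y).adjMatrix (ZMod p) := by
    ext i j
    have hadj : X.Adj i j ↔ i ≠ j :=
      ⟨fun h hij => h.ne (congrArg _ hij), fun h => hY i.2 j.2 (Subtype.coe_ne_coe.mpr h)⟩
    simp [SimpleGraph.adjMatrix_apply, hadj]
  calc Y.card = ((X.adjMatrix (ZMod p)).submatrix (Subtype.val : Y → V) Subtype.val).rank := by
        rw [hsub, Matrix.rank_of_isUnit _ (SimpleGraph.isUnit_adjMatrix_top hcard),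
          Fintype.card_coe]
    _ ≤ (X.adjMatrix (ZMod p)).rank := Matrix.rank_submatrix_le _ _ _
end

section
/- Let p be a prime, t ≥ 1, and q = p^t. Every partial spread Y of the Hermitian polar space H(3, q^2) satisfies |Y| ≤ ((2p^3 + p)/3)^t + 1. -/
open Polynomial in
/-- The action of a `2 × 2` matrix on binary forms of degree `m`, in the monomial basis. -/
noncomputable def binarySymPow {K : Type*} [CommRing K] (m : ℕ) (T : Matrix (Fin 2) (Fin 2) K) :
    Matrix (Fin (m + 1)) (Fin (m + 1)) K :=
  Matrix.of fun i k =>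
    ((C (T 0 0) * X + C (T 0 1)) ^ (i : ℕ) * (C (T 1 0) * X + C (T 1 1)) ^ (m - i : ℕ)).coeff k

namespace binarySymPow

open Polynomial

variable {K : Type*} [CommRing K] {m : ℕ}

lemma sum_algebraMap_mul {A : Type*} [CommRing A] [Algebra K A] (T : Matrix (Fin 2) (Fin 2) K)
    (i : Fin (m + 1)) (x y : A) :
    ∑ k : Fin (m + 1), algebraMap K A (binarySymPow m T i k) * (x ^ (k : ℕ) * y ^ (m - k : ℕ)) =
      (algebraMap K A (T 0 0) * x + algebraMap K A (T 0 1) * y) ^ (i : ℕ) *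
        (algebraMap K A (T 1 0) * x + algebraMap K A (T 1 1) * y) ^ (m - i : ℕ) := by
  have hlin (a b : K) :
      ((MvPolynomial.C a * .X 0 + .C b * .X 1 : MvPolynomial (Fin 2) K)).IsHomogeneous 1 :=
    ((MvPolynomial.isHomogeneous_X K 0).C_mul a).add ((MvPolynomial.isHomogeneous_X K 1).C_mul b)
  have hhom := ((hlin (T 0 0) (T 0 1)).pow i).mul ((hlin (T 1 0) (T 1 1)).pow (m - i))
  rw [show 1 * (i : ℕ) + 1 * (m - i) = m by omega] at hhom
  have := homogenize_eq_of_isHomogeneous hhom rfl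
  apply_fun MvPolynomial.aeval ![x, y] at this
  simp only [homogenize, Finset.Nat.sum_antidiagonal_eq_sum_range_succ_mk] at this
  rw [← Fin.sum_univ_eq_sum_range (fun k => MvPolynomial.monomial _ _)] at this
  simpa [MvPolynomial.aeval_monomial, Finsupp.prod_fintype, binarySymPow,
    MvPolynomial.algebraMap_eq, Polynomial.algebraMap_eq] using this

protected lemma mul (S T : Matrix (Fin 2) (Fin 2) K) :
    binarySymPow m (S * T) = binarySymPow m S * binarySymPow m T := by
  ext i l
  have hrow (U : Matrix (Fin 2) (Fin 2) K) (j : Fin (m + 1)) := by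
    simpa using sum_algebraMap_mul (A := K[X]) U j X 1
  have h := sum_algebraMap_mul (A := K[X]) S i (C (T 0 0) * X + C (T 0 1))
    (C (T 1 0) * X + C (T 1 1))
  have key : ∑ k : Fin (m + 1), C ((binarySymPow m S * binarySymPow m T) i k) * X ^ (k : ℕ) =
      ∑ k : Fin (m + 1), C (binarySymPow m (S * T) i k) * X ^ (k : ℕ) := by
    rw [hrow]
    simp only [Matrix.mul_apply, map_sum, Finset.sum_mul]
    rw [Finset.sum_comm]
    simp only [map_mul, mul_assoc, ← Finset.mul_sum, hrow]
    rw [Polynomial.algebraMap_eq] at h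
    rw [h]
    simp only [Fin.sum_univ_two]
    ring
  have := congrArg (fun P => P.coeff (l : ℕ)) key
  simpa [finsetSum_coeff, coeff_X_pow, Fin.val_inj] using this.symm

lemma trace_mul_comm (S T : Matrix (Fin 2) (Fin 2) K) :
    (binarySymPow m (S * T)).trace = (binarySymPow m (T * S)).trace := by
  rw [binarySymPow.mul, binarySymPow.mul, Matrix.trace_mul_comm]

lemma trace_of_triangular {T : Matrix (Fin 2) (Fin 2) K} (h : T 0 1 = 0 ∨ T 1 0 = 0) :
    (binarySymPow m T).trace = ∑ i ∈ Finset.range (m + 1), T 0 0 ^ i * T 1 1 ^ (m - i) := by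
  rw [← Fin.sum_univ_eq_sum_range (fun i => T 0 0 ^ i * T 1 1 ^ (m - i)), Matrix.trace]
  refine Finset.sum_congr rfl fun i _ => ?_
  rcases h with h | h
  · rw [Matrix.diag_apply, binarySymPow, Matrix.of_apply, h]
    simp only [map_zero, add_zero, mul_pow, ← C_pow, mul_assoc, coeff_C_mul, coeff_X_pow_mul']
    simp [coeff_zero_eq_eval_zero]
  · rw [Matrix.diag_apply, binarySymPow, Matrix.of_apply, h]
    simp only [map_zero, zero_mul, zero_add, ← C_pow, coeff_mul_C]
    congr 1
    have := coeff_pow_of_natDegree_le (p := C (T 0 0) * X + C (T 0 1)) (n := 1) (m := (i : ℕ))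
      natDegree_linear_le
    simpa using this

/-- Over an algebraically closed field the trace on binary forms is the complete homogeneous
symmetric polynomial of the eigenvalues. -/
lemma exists_eigenvalues {K : Type*} [Field K] [IsAlgClosed K] (T : Matrix (Fin 2) (Fin 2) K) :
    ∃ r s : K, T.trace = r + s ∧ T.det = r * s ∧
      ∀ m, (binarySymPow m T).trace = ∑ i ∈ Finset.range (m + 1), r ^ i * s ^ (m - i) := by
  rcases eq_or_ne (T 1 0) 0 with h | h
  · exact ⟨T 0 0, T 1 1, by simp [Matrix.trace_fin_two], by simp [Matrix.det_fin_two, h],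
      fun m => trace_of_triangular (.inr h)⟩
  · obtain ⟨z, hz⟩ := IsAlgClosed.exists_root
      (C (T 1 0) * X ^ 2 + C (T 0 0 - T 1 1) * X + C (-T 0 1)) (by rw [degree_quadratic h]; decide)
    simp only [IsRoot, eval_add, eval_mul, eval_C, eval_pow, eval_X] at hz
    set P : Matrix (Fin 2) (Fin 2) K := !![1, z; 0, 1]
    set Q : Matrix (Fin 2) (Fin 2) K := !![1, -z; 0, 1]
    have hQP : Q * P = 1 := by simp [P, Q, Matrix.one_fin_two]
    have hU : P * T * Q = !![T 0 0 + z * T 1 0, 0; T 1 0, T 1 1 - z * T 1 0] := by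
      ext i j
      fin_cases i <;> fin_cases j <;>
        simp [P, Q, Matrix.mul_apply, Fin.sum_univ_two, Matrix.vecMul, dotProduct] <;>
          first | ring1 | linear_combination -hz
    refine ⟨T 0 0 + z * T 1 0, T 1 1 - z * T 1 0, by rw [Matrix.trace_fin_two]; ring,
      by rw [Matrix.det_fin_two]; linear_combination T 1 0 * hz, fun m => ?_⟩
    have h1 := trace_mul_comm (m := m) (P * T) Q
    rw [← mul_assoc, hQP, one_mul, hU] at h1
    rw [← h1, trace_of_triangular (.inl (by simp))]
    simp

end binarySymPow

lemma geom_sum₂_mul_geom_sum₂ {R : Type*} [CommRing R] (n : ℕ) (a r s : R) :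
    (∑ j ∈ Finset.range (n + 1), r ^ j * a ^ (n - j)) *
        ∑ k ∈ Finset.range (n + 1), s ^ k * a ^ (n - k) =
      (∑ m ∈ Finset.range (n + 1),
          a ^ (2 * n - m) * ∑ i ∈ Finset.range (m + 1), r ^ i * s ^ (m - i)) +
        ∑ m ∈ Finset.range n,
          (r * s) ^ (n - m) * a ^ m * ∑ i ∈ Finset.range (m + 1), r ^ i * s ^ (m - i) := by
  rw [Finset.sum_mul_sum, ← Finset.sum_product',
    ← Finset.sum_filter_add_sum_filter_not _ (fun jk : ℕ × ℕ => jk.1 + jk.2 ≤ n)]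
  simp only [Finset.mul_sum]
  rw [Finset.sum_sigma', Finset.sum_sigma']
  congr 1
  · refine Finset.sum_nbij' (fun jk => ⟨jk.1 + jk.2, jk.1⟩) (fun mi => (mi.2, mi.1 - mi.2))
      ?_ ?_ ?_ ?_ ?_
    · rintro ⟨j, k⟩ h
      simp only [Finset.mem_filter, Finset.mem_product, Finset.mem_range, Finset.mem_sigma] at h ⊢
      omega
    · rintro ⟨m, i⟩ h
      simp only [Finset.mem_filter, Finset.mem_product, Finset.mem_range, Finset.mem_sigma] at h ⊢
      omega
    · rintro ⟨j, k⟩ h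
      simp
    · rintro ⟨m, i⟩ h
      simp only [Finset.mem_range, Finset.mem_sigma] at h
      simp only [Sigma.mk.injEq, heq_eq_eq, and_true]
      omega
    · rintro ⟨j, k⟩ h
      simp only [Finset.mem_filter, Finset.mem_product, Finset.mem_range] at h
      simp only [Nat.add_sub_cancel_left]
      rw [show 2 * n - (j + k) = (n - j) + (n - k) by omega, pow_add]
      ring
  · refine Finset.sum_nbij' (fun jk => ⟨2 * n - (jk.1 + jk.2), n - jk.2⟩)
      (fun mi => (n - mi.1 + mi.2, n - mi.2)) ?_ ?_ ?_ ?_ ?_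
    · rintro ⟨j, k⟩ h
      simp only [Finset.mem_filter, Finset.mem_product, Finset.mem_range, Finset.mem_sigma] at h ⊢
      omega
    · rintro ⟨m, i⟩ h
      simp only [Finset.mem_filter, Finset.mem_product, Finset.mem_range, Finset.mem_sigma] at h ⊢
      omega
    · rintro ⟨j, k⟩ h
      simp only [Finset.mem_filter, Finset.mem_product, Finset.mem_range] at h
      simp only [Prod.mk.injEq]
      omega
    · rintro ⟨m, i⟩ h
      simp only [Finset.mem_range, Finset.mem_sigma] at h
      simp only [Sigma.mk.injEq, heq_eq_eq]
      omega
    · rintro ⟨j, k⟩ h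
      simp only [Finset.mem_filter, Finset.mem_product, Finset.mem_range] at h
      obtain ⟨c, hc⟩ : ∃ c, n = k + c := ⟨n - k, by omega⟩
      obtain ⟨d, hd⟩ : ∃ d, n = j + d := ⟨n - j, by omega⟩
      obtain ⟨e, rfl⟩ : ∃ e, j = e + c := ⟨j - c, by omega⟩
      obtain rfl : k = e + d := by omega
      subst hc
      simp only
      rw [show e + d + c - (2 * (e + d + c) - (e + c + (e + d))) = e by omega,
        show 2 * (e + d + c) - (e + c + (e + d)) - (e + d + c - (e + d)) = d by omega,
        show 2 * (e + d + c) - (e + c + (e + d)) = d + c by omega,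
        show e + d + c - (e + c) = d by omega, show e + d + c - (e + d) = c by omega]
      ring

section CharP

variable {K : Type*} [Field K] (p : ℕ) [Fact p.Prime] [CharP K p]

lemma sub_pow_char_sub_one_eq_geom_sum₂ (x y : K) :
    (x - y) ^ (p - 1) = ∑ i ∈ Finset.range (p - 1 + 1), y ^ i * x ^ (p - 1 - i) := by
  have hp := (Fact.out : p.Prime).one_lt
  have hp1 : p - 1 + 1 = p := by omega
  have h := (Commute.all x y).geom_sum₂_mul p
  rw [← sub_pow_char x y, (Commute.all x y).geom_sum₂_comm] at h
  rw [hp1]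
  rcases eq_or_ne x y with rfl | hxy
  · rw [sub_self, zero_pow (by omega), Finset.sum_congr rfl fun i hi =>
      show x ^ i * x ^ (p - 1 - i) = x ^ (p - 1) by
        rw [← pow_add]; congr 1; have := Finset.mem_range.1 hi; omega]
    simp
  · refine (mul_right_cancel₀ (sub_ne_zero.2 hxy) ?_).symm
    rw [h, ← pow_succ, hp1]

lemma add_sub_add_pow_char_sub_one {a b r s : K} (h : a * b = r * s) :
    (a + b - (r + s)) ^ (p - 1) =
      (∑ m ∈ Finset.range (p - 1 + 1),
          a ^ (p - 1 - m) * ∑ i ∈ Finset.range (m + 1), r ^ i * s ^ (m - i)) +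
        ∑ m ∈ Finset.range (p - 1),
          b ^ (p - 1 - m) * ∑ i ∈ Finset.range (m + 1), r ^ i * s ^ (m - i) := by
  have hgeom := sub_pow_char_sub_one_eq_geom_sum₂ (K := K) p
  generalize p - 1 = n at hgeom ⊢
  rcases eq_or_ne a 0 with rfl | ha
  · have hb (c : K) (hc : ∀ m, ∑ i ∈ Finset.range (m + 1), r ^ i * s ^ (m - i) = c ^ m) :
        (∑ m ∈ Finset.range (n + 1),
          0 ^ (n - m) * ∑ i ∈ Finset.range (m + 1), r ^ i * s ^ (m - i)) +
        ∑ m ∈ Finset.range n, b ^ (n - m) * ∑ i ∈ Finset.range (m + 1), r ^ i * s ^ (m - i) =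
        (b - c) ^ n := by
      simp only [hc]
      rw [hgeom, Finset.sum_range_succ, Finset.sum_eq_zero fun m hm => by
        rw [zero_pow (by have := Finset.mem_range.1 hm; omega), zero_mul],
        Finset.sum_range_succ]
      simp [mul_comm, add_comm]
    rcases mul_eq_zero.1 (h.symm.trans (zero_mul b)) with rfl | rfl
    · rw [hb s fun m => by simp [Finset.sum_range_succ']]
      simp
    · rw [hb r fun m => by
        rw [Finset.sum_range_succ, Finset.sum_eq_zero fun i hi => by
          rw [zero_pow (by have := Finset.mem_range.1 hi; omega), mul_zero]]
        simp]
      simp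
  · have hdouble := geom_sum₂_mul_geom_sum₂ n a r s
    rw [← hgeom, ← hgeom, ← mul_pow,
      show (a - r) * (a - s) = a * (a + b - (r + s)) by linear_combination -h, mul_pow] at hdouble
    refine mul_left_cancel₀ (pow_ne_zero n ha) (hdouble.trans ?_)
    rw [mul_add, Finset.mul_sum, Finset.mul_sum]
    congr 1 <;> refine Finset.sum_congr rfl fun m hm => ?_
    · have := Finset.mem_range.1 hm
      rw [← mul_assoc, ← pow_add]
      congr 2
      omega
    · have := Finset.mem_range.1 hm
      rw [← h, mul_pow, ← mul_assoc]
      congr 1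
      nth_rw 3 [show n = (n - m) + m by omega]
      ring

end CharP

/-- The determinant of the `4 × 4` matrix whose rows are the rows of `x` followed by those of
`y`. -/
def joinDet {K : Type*} [CommRing K] (x y : Fin 2 → Fin 4 → K) : K :=
  (Matrix.of ![x 0, x 1, y 0, y 1]).det

namespace joinDet

variable {K : Type*} [CommRing K]

lemma eq_minors (x y : Fin 2 → Fin 4 → K) :
    joinDet x y =
      (x 0 0 * x 1 1 - x 0 1 * x 1 0) * (y 0 2 * y 1 3 - y 0 3 * y 1 2) -
      (x 0 0 * x 1 2 - x 0 2 * x 1 0) * (y 0 1 * y 1 3 - y 0 3 * y 1 1) +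
      (x 0 0 * x 1 3 - x 0 3 * x 1 0) * (y 0 1 * y 1 2 - y 0 2 * y 1 1) +
      (x 0 1 * x 1 2 - x 0 2 * x 1 1) * (y 0 0 * y 1 3 - y 0 3 * y 1 0) -
      (x 0 1 * x 1 3 - x 0 3 * x 1 1) * (y 0 0 * y 1 2 - y 0 2 * y 1 0) +
      (x 0 2 * x 1 3 - x 0 3 * x 1 2) * (y 0 0 * y 1 1 - y 0 1 * y 1 0) := by
  simp [joinDet, Matrix.det_succ_row_zero, Fin.sum_univ_succ, Fin.succAbove]
  ring

lemma comm (x y : Fin 2 → Fin 4 → K) : joinDet x y = joinDet y x := by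
  rw [eq_minors, eq_minors]
  ring

lemma self_eq_zero (x : Fin 2 → Fin 4 → K) : joinDet x x = 0 := by
  rw [eq_minors]
  ring

lemma map {L : Type*} [CommRing L] (f : K →+* L) (x y : Fin 2 → Fin 4 → K) :
    joinDet (fun i j => f (x i j)) (fun i j => f (y i j)) = f (joinDet x y) := by
  simp [eq_minors]

/-- The left `2 × 2` block of a `2 × 4` matrix. -/
def leftBlock (x : Fin 2 → Fin 4 → K) : Matrix (Fin 2) (Fin 2) K :=
  !![x 0 0, x 0 1; x 1 0, x 1 1]

/-- The right `2 × 2` block of a `2 × 4` matrix. -/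
def rightBlock (x : Fin 2 → Fin 4 → K) : Matrix (Fin 2) (Fin 2) K :=
  !![x 0 2, x 0 3; x 1 2, x 1 3]

lemma eq_blocks (x y : Fin 2 → Fin 4 → K) :
    joinDet x y = (leftBlock x).det * (rightBlock y).det + (rightBlock x).det * (leftBlock y).det -
      ((leftBlock x).adjugate * rightBlock x *
        ((rightBlock y).adjugate * leftBlock y)).trace := by
  simp [eq_minors, leftBlock, rightBlock, Matrix.det_fin_two, Matrix.trace_fin_two]
  ring

/-- Indices for pairs of a degree `m` and an entry of the `m`-th symmetric power of a `2 × 2`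
matrix, for `m ≤ n` and again for `m < n`. -/
abbrev PowIndex (n : ℕ) : Type :=
  (Σ m : Fin (n + 1), Fin (m + 1) × Fin (m + 1)) ⊕ (Σ m : Fin n, Fin (m + 1) × Fin (m + 1))

lemma card_powIndex {p : ℕ} (hp : 1 ≤ p) :
    Fintype.card (PowIndex (p - 1)) = (2 * p ^ 3 + p) / 3 := by
  obtain ⟨n, rfl⟩ := Nat.exists_eq_add_of_le' hp
  have h (n : ℕ) : 6 * ∑ m ∈ Finset.range n, (m + 1) * (m + 1) = n * (n + 1) * (2 * n + 1) := by
    induction n with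
    | zero => simp
    | succ n ih => rw [Finset.sum_range_succ, mul_add, ih]; ring
  simp only [Nat.add_sub_cancel, Fintype.card_sum, Fintype.card_sigma, Fintype.card_prod,
    Fintype.card_fin]
  rw [Fin.sum_univ_eq_sum_range (fun m => (m + 1) * (m + 1)),
    Fin.sum_univ_eq_sum_range (fun m => (m + 1) * (m + 1))]
  have h1 := h n
  have h2 := h (n + 1)
  have h3 : (n + 1) * (n + 1 + 1) * (2 * (n + 1) + 1) + n * (n + 1) * (2 * n + 1) =
      2 * (2 * (n + 1) ^ 3 + (n + 1)) := by ring
  omega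

lemma exists_pow_char_sub_one_eq_sum {K : Type*} [Field K] [IsAlgClosed K] (p : ℕ)
    [Fact p.Prime] [CharP K p] :
    ∃ f g : PowIndex (p - 1) → (Fin 2 → Fin 4 → K) → K,
      ∀ x y, joinDet x y ^ (p - 1) = ∑ j, f j x * g j y := by
  generalize hn : p - 1 = n
  refine ⟨Sum.elim
      (fun j x => (leftBlock x).det ^ (n - j.1) *
        binarySymPow j.1 ((leftBlock x).adjugate * rightBlock x) j.2.1 j.2.2)
      (fun j x => (rightBlock x).det ^ (n - j.1) *
        binarySymPow j.1 ((leftBlock x).adjugate * rightBlock x) j.2.1 j.2.2),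
    Sum.elim
      (fun j y => (rightBlock y).det ^ (n - j.1) *
        binarySymPow j.1 ((rightBlock y).adjugate * leftBlock y) j.2.2 j.2.1)
      (fun j y => (leftBlock y).det ^ (n - j.1) *
        binarySymPow j.1 ((rightBlock y).adjugate * leftBlock y) j.2.2 j.2.1), fun x y => ?_⟩
  obtain ⟨r, s, htr, hdet, hsym⟩ := binarySymPow.exists_eigenvalues
    ((leftBlock x).adjugate * rightBlock x * ((rightBlock y).adjugate * leftBlock y))
  have h := add_sub_add_pow_char_sub_one p (a := (leftBlock x).det * (rightBlock y).det)
    (b := (rightBlock x).det * (leftBlock y).det) (r := r) (s := s) (by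
      rw [← hdet]
      simp only [Matrix.det_mul, Matrix.det_adjugate, Fintype.card_fin, Nat.add_one_sub_one,
        pow_one]
      ring)
  rw [← htr, ← eq_blocks, hn] at h
  simp only [← hsym, binarySymPow.mul ((leftBlock x).adjugate * rightBlock x)
    ((rightBlock y).adjugate * leftBlock y)] at h
  rw [h, Fintype.sum_sum_type, Fintype.sum_sigma, Fintype.sum_sigma, ← Fin.sum_univ_eq_sum_range
    (fun m => ((leftBlock x).det * (rightBlock y).det) ^ (n - m) * Matrix.trace _),
    ← Fin.sum_univ_eq_sum_range
    (fun m => ((rightBlock x).det * (leftBlock y).det) ^ (n - m) * Matrix.trace _)]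
  simp only [Fintype.sum_prod_type, Matrix.trace, Matrix.diag_apply, Matrix.mul_apply,
    Finset.mul_sum, Sum.elim_inl, Sum.elim_inr]
  congr 1 <;>
    exact Finset.sum_congr rfl fun m _ => Finset.sum_congr rfl fun i _ =>
      Finset.sum_congr rfl fun k _ => by ring

lemma exists_pow_eq_sum {K : Type*} [Field K] [IsAlgClosed K] (p t : ℕ)
    [Fact p.Prime] [CharP K p] :
    ∃ f g : (Fin t → PowIndex (p - 1)) → (Fin 2 → Fin 4 → K) → K,
      ∀ x y, joinDet x y ^ (p ^ t - 1) = ∑ j, f j x * g j y := by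
  obtain ⟨f, g, hfg⟩ := exists_pow_char_sub_one_eq_sum (K := K) p
  refine ⟨fun j x => ∏ l, f (j l) x ^ p ^ (l : ℕ), fun j y => ∏ l, g (j l) y ^ p ^ (l : ℕ),
    fun x y => ?_⟩
  have hexp : p ^ t - 1 = ∑ l : Fin t, (p - 1) * p ^ (l : ℕ) := by
    rw [Fin.sum_univ_eq_sum_range (fun l => (p - 1) * p ^ l), ← Finset.mul_sum, mul_comm,
      Nat.geomSum_eq (Fact.out : p.Prime).two_le,
      Nat.div_mul_cancel (Nat.sub_one_dvd_pow_sub_one p t)]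
  rw [hexp, ← Finset.prod_pow_eq_pow_sum]
  simp only [pow_mul, hfg, sum_pow_char_pow, mul_pow, ← Finset.prod_mul_distrib]
  rw [Finset.prod_univ_sum, Fintype.piFinset_univ]

end joinDet

lemma Matrix.card_le_card_of_diagonal_eq_mul {K ι κ : Type*} [Field K] [Fintype ι] [DecidableEq ι]
    [Fintype κ] {d : ι → K} (hd : ∀ i, d i ≠ 0) {A : Matrix ι κ K} {B : Matrix κ ι K}
    (h : Matrix.diagonal d = A * B) : Fintype.card ι ≤ Fintype.card κ := by
  have hu : IsUnit (A * B) := by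
    rw [← h, Matrix.isUnit_iff_isUnit_det, Matrix.det_diagonal]
    exact (Finset.prod_ne_zero_iff.2 fun i _ => hd i).isUnit
  rw [← Matrix.rank_of_isUnit _ hu]
  exact (Matrix.rank_mul_le_left A B).trans (Matrix.rank_le_card_width A)

section Hermitian

variable {F : Type*} [Field F]

/-- The form `∑ i, x i * y i ^ q` on `F⁴`. -/
def hermForm (q : ℕ) (x y : Fin 4 → F) : F := ∑ i, x i * y i ^ q

/-- The determinant of the Gram matrix of the rows of `y` against the rows of `x`. -/
def gramDet (q : ℕ) (x y : Fin 2 → Fin 4 → F) : F :=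
  hermForm q (y 0) (x 0) * hermForm q (y 1) (x 1) - hermForm q (y 0) (x 1) * hermForm q (y 1) (x 0)

variable {p t : ℕ} [Fact p.Prime] [CharP F p]

lemma hermForm_pow [Fintype F] (hF : Fintype.card F = (p ^ t) ^ 2) (x y : Fin 4 → F) :
    hermForm (p ^ t) x y ^ p ^ t = hermForm (p ^ t) y x := by
  simp only [hermForm, sum_pow_char_pow, mul_pow]
  refine Finset.sum_congr rfl fun i _ => ?_
  rw [← pow_mul, ← sq, ← hF, FiniteField.pow_card, mul_comm]

lemma gramDet_pow [Fintype F] (hF : Fintype.card F = (p ^ t) ^ 2) (x y : Fin 2 → Fin 4 → F) :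
    gramDet (p ^ t) x y ^ p ^ t = gramDet (p ^ t) y x := by
  simp only [gramDet, sub_pow_char_pow, mul_pow, hermForm_pow hF]
  ring

lemma exists_gramDet_eq_mul_joinDet {x z : Fin 2 → Fin 4 → F}
    (hx : ∀ i j, hermForm (p ^ t) (x i) (x j) = 0) (hz : joinDet x z ≠ 0) :
    ∃ c : F, c ≠ 0 ∧ ∀ y, gramDet (p ^ t) x y = c * joinDet x y := by
  have hspan (u : Fin 4 → F) : ∃ a : Fin 4 → F,
      ∀ j, u j = a 0 * x 0 j + a 1 * x 1 j + a 2 * z 0 j + a 3 * z 1 j := by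
    refine ⟨Matrix.vecMul u (Matrix.of ![x 0, x 1, z 0, z 1])⁻¹, fun j => ?_⟩
    have h := Matrix.vecMul_vecMul u (Matrix.of ![x 0, x 1, z 0, z 1])⁻¹
      (Matrix.of ![x 0, x 1, z 0, z 1])
    rw [Matrix.nonsing_inv_mul _ (isUnit_iff_ne_zero.2 hz), Matrix.vecMul_one] at h
    have hj := congrFun h j
    simpa [Matrix.vecMul, dotProduct, Fin.sum_univ_four] using hj.symm
  have hprop (y : Fin 2 → Fin 4 → F) :
      gramDet (p ^ t) x y * joinDet x z = gramDet (p ^ t) x z * joinDet x y := by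
    obtain ⟨a, ha⟩ := hspan (y 0)
    obtain ⟨b, hb⟩ := hspan (y 1)
    have hlin {u : Fin 4 → F} {a : Fin 4 → F}
        (hu : ∀ j, u j = a 0 * x 0 j + a 1 * x 1 j + a 2 * z 0 j + a 3 * z 1 j) (i : Fin 2) :
        hermForm (p ^ t) u (x i) =
          a 2 * hermForm (p ^ t) (z 0) (x i) + a 3 * hermForm (p ^ t) (z 1) (x i) := by
      have h0 := hx 0 i
      have h1 := hx 1 i
      simp only [hermForm, Fin.sum_univ_four, hu] at h0 h1 ⊢
      linear_combination a 0 * h0 + a 1 * h1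
    have hdet : joinDet x y = (a 2 * b 3 - a 3 * b 2) * joinDet x z := by
      simp only [joinDet.eq_minors, ha, hb]
      ring
    rw [hdet, gramDet, gramDet, hlin ha, hlin ha, hlin hb, hlin hb]
    ring
  refine ⟨gramDet (p ^ t) x z / joinDet x z, ?_, fun y => ?_⟩
  · refine div_ne_zero (fun h0 => hz ?_) hz
    have hminor (i j : Fin 4) : x 0 i * x 1 j - x 0 j * x 1 i = 0 := by
      have h := hprop ![Pi.single i 1, Pi.single j 1]
      rw [h0, zero_mul] at h
      have h' := (mul_eq_zero.1 h).resolve_right hz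
      simp only [gramDet, hermForm, Matrix.cons_val_zero, Matrix.cons_val_one, Pi.single_apply,
        ite_mul, one_mul, zero_mul, Finset.sum_ite_eq', Finset.mem_univ, if_true,
        ← mul_pow, ← sub_pow_char_pow] at h'
      have h'' := eq_zero_of_pow_eq_zero h'
      linear_combination h''
    simp [joinDet.eq_minors, hminor]
  · rw [div_mul_eq_mul_div, ← hprop, mul_div_cancel_right₀ _ hz]

lemma joinDet_pow_sub_one [Fintype F] (hF : Fintype.card F = (p ^ t) ^ 2)
    {x y : Fin 2 → Fin 4 → F} {c d : F} (hc : c ≠ 0)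
    (hx : ∀ y, gramDet (p ^ t) x y = c * joinDet x y)
    (hy : ∀ x, gramDet (p ^ t) y x = d * joinDet y x) (h : joinDet x y ≠ 0) :
    joinDet x y ^ (p ^ t - 1) = (c ^ p ^ t)⁻¹ * d := by
  have key := gramDet_pow hF x y
  rw [hx, hy, joinDet.comm y x, mul_pow,
    ← Nat.sub_add_cancel (Nat.one_le_pow t p (Fact.out : p.Prime).pos), pow_succ (joinDet x y),
    Nat.sub_add_cancel (Nat.one_le_pow t p (Fact.out : p.Prime).pos), ← mul_assoc] at key
  rw [eq_inv_mul_iff_mul_eq₀ (pow_ne_zero _ hc)]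
  exact mul_right_cancel₀ h key

end Hermitian

lemma joinDet_ne_zero_of_inf_eq_bot {F : Type*} [Field F] {U W : Submodule F (Fin 4 → F)}
    {x y : Fin 2 → Fin 4 → F} (hx : LinearIndependent F x) (hy : LinearIndependent F y)
    (hxU : ∀ i, x i ∈ U) (hyW : ∀ i, y i ∈ W) (h : U ⊓ W = ⊥) : joinDet x y ≠ 0 := by
  intro h0
  obtain ⟨a, ha, hzero⟩ := Matrix.exists_vecMul_eq_zero_iff.2 h0
  have hsum : a 0 • x 0 + a 1 • x 1 = -(a 2 • y 0 + a 3 • y 1) := by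
    ext j
    have := congrFun hzero j
    simp only [Matrix.vecMul, dotProduct, Fin.sum_univ_four, Matrix.of_apply, Matrix.cons_val,
      Pi.zero_apply] at this
    simp only [Pi.add_apply, Pi.smul_apply, Pi.neg_apply, smul_eq_mul]
    linear_combination this
  have hU : a 0 • x 0 + a 1 • x 1 ∈ U :=
    U.add_mem (U.smul_mem _ (hxU 0)) (U.smul_mem _ (hxU 1))
  have hW : a 2 • y 0 + a 3 • y 1 ∈ W :=
    W.add_mem (W.smul_mem _ (hyW 0)) (W.smul_mem _ (hyW 1))
  have hx0 : a 0 • x 0 + a 1 • x 1 = 0 :=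
    (Submodule.mem_bot F).1 (h ▸ ⟨hU, hsum ▸ W.neg_mem hW⟩)
  have hy0 : a 2 • y 0 + a 3 • y 1 = 0 := by rw [hx0] at hsum; exact neg_eq_zero.1 hsum.symm
  have hxa := Fintype.linearIndependent_iff.1 hx ![a 0, a 1] (by simpa [Fin.sum_univ_two] using hx0)
  have hya := Fintype.linearIndependent_iff.1 hy ![a 2, a 3] (by simpa [Fin.sum_univ_two] using hy0)
  refine ha (funext fun i => ?_)
  fin_cases i
  exacts [hxa 0, hxa 1, hya 0, hya 1]

/-- Theorem 1(a): a partial spread `Y` of the Hermitian polar space `H(3, q²)`, `q = pᵗ`,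
satisfies `|Y| ≤ ((2p³ + p)/3)ᵗ + 1`.  Here `F` is the field with `q²` elements,
generators are the `2`-dimensional subspaces of `F⁴` that are totally isotropic for the
Hermitian form `h(x,y) = Σᵢ xᵢ yᵢ^q`, and members of a partial spread pairwise meet in `⊥`. -/
theorem partial_spread_H3_bound (p t : ℕ) (hp : p.Prime) (ht : 1 ≤ t)
    (F : Type) [Field F] [Fintype F] (hF : Fintype.card F = (p ^ t) ^ 2)
    (Y : Finset (Submodule F (Fin 4 → F)))
    (hgen : ∀ W ∈ Y, Module.finrank F W = 2 ∧
      ∀ x ∈ W, ∀ y ∈ W, ∑ i, x i * y i ^ (p ^ t) = 0)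
    (hspread : ∀ a ∈ Y, ∀ b ∈ Y, a ≠ b → a ⊓ b = ⊥) :
    Y.card ≤ ((2 * p ^ 3 + p) / 3) ^ t + 1 := by
  classical
  rcases Nat.lt_or_ge 1 Y.card with hY | hY
  swap
  · omega
  have : Fact p.Prime := ⟨hp⟩
  have : CharP F p := charP_of_card_eq_prime_pow (f := t * 2) (by rw [hF, pow_mul])
  let K := AlgebraicClosure F
  have : CharP K p := charP_of_injective_algebraMap (algebraMap F K).injective p
  have hbasis (W : Y) : ∃ x : Fin 2 → Fin 4 → F, LinearIndependent F x ∧ ∀ i, x i ∈ W.1 := by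
    let b := Module.finBasisOfFinrankEq F W.1 (hgen W.1 W.2).1
    exact ⟨fun i => (b i : Fin 4 → F),
      b.linearIndependent.map' W.1.subtype W.1.ker_subtype, fun i => (b i).2⟩
  choose x hxli hxmem using hbasis
  have hdet (U W : Y) (h : U ≠ W) : joinDet (x U) (x W) ≠ 0 :=
    joinDet_ne_zero_of_inf_eq_bot (hxli U) (hxli W) (hxmem U) (hxmem W)
      (hspread U.1 U.2 W.1 W.2 (Subtype.coe_injective.ne h))
  have hscalar (U : Y) :
      ∃ c : F, c ≠ 0 ∧ ∀ y, gramDet (p ^ t) (x U) y = c * joinDet (x U) y := by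
    have : Nontrivial Y := Fintype.one_lt_card_iff_nontrivial.1 (by simpa using hY)
    obtain ⟨W, hW⟩ := exists_ne U
    exact exists_gramDet_eq_mul_joinDet
      (fun i j => (hgen U.1 U.2).2 _ (hxmem U i) _ (hxmem U j)) (hdet U W hW.symm)
  choose c hc0 hc using hscalar
  obtain ⟨f, g, hfg⟩ := joinDet.exists_pow_eq_sum (K := K) p t
  let φ := algebraMap F K
  let xK (U : Y) : Fin 2 → Fin 4 → K := fun i j => φ (x U i j)
  have hoff (U W : Y) : (if U = W then φ ((c U ^ p ^ t)⁻¹ * c U) else 0) =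
      φ ((c U ^ p ^ t)⁻¹ * c W) - ∑ j, f j (xK U) * g j (xK W) := by
    rw [← hfg, joinDet.map, ← map_pow, ← map_sub]
    split_ifs with h
    · subst h
      rw [joinDet.self_eq_zero, zero_pow, sub_zero]
      have := Nat.one_lt_pow (by omega : t ≠ 0) hp.one_lt
      omega
    · rw [joinDet_pow_sub_one hF (hc0 U) (hc U) (hc W) (hdet U W h), sub_self, map_zero]
  let A : Matrix Y (Option (Fin t → joinDet.PowIndex (p - 1))) K :=
    Matrix.of fun U o => o.elim (φ (c U ^ p ^ t)⁻¹) fun j => -f j (xK U)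
  let B : Matrix (Option (Fin t → joinDet.PowIndex (p - 1))) Y K :=
    Matrix.of fun o W => o.elim (φ (c W)) fun j => g j (xK W)
  have hAB : Matrix.diagonal (fun U => φ ((c U ^ p ^ t)⁻¹ * c U)) = A * B := by
    ext U W
    rw [Matrix.diagonal_apply, hoff, Matrix.mul_apply, Fintype.sum_option]
    simp only [A, B, Matrix.of_apply, Option.elim_none, Option.elim_some, map_mul, sub_eq_add_neg]
    refine congrArg _ ((Finset.sum_neg_distrib _).symm.trans ?_)
    exact Finset.sum_congr rfl fun j _ => (neg_mul _ _).symm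
  have hcard := Matrix.card_le_card_of_diagonal_eq_mul (fun U => by
    rw [map_ne_zero]
    exact mul_ne_zero (inv_ne_zero (pow_ne_zero _ (hc0 U))) (hc0 U)) hAB
  simpa [joinDet.card_powIndex hp.one_le, -Fintype.card_sum, -Fintype.card_sigma] using hcard
end

section
/- Let p = 3, t ≥ 1, and q = 3^t. Every partial spread Y of the Hermitian polar space H(3, q^2) satisfies |Y| ≤ 19^t. -/
/-- If a matrix with zero diagonal and entries `c a * c b` off the diagonal factors through `κ`,
and the size of the matrix is `2` in the field, then that size is at most `card κ`. -/
theorem card_le_of_factorization_off_diagonal {F ι κ : Type*} [Field F] [Fintype ι]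
    [DecidableEq ι] [Fintype κ] (c : ι → F) (hc : ∀ a, c a ≠ 0) (f g : ι → κ → F)
    (hfg : ∀ a b, ∑ k, f a k * g b k = if a = b then 0 else c a * c b)
    (hcard : (Fintype.card ι : F) = 2) : Fintype.card ι ≤ Fintype.card κ := by
  classical
  let A : Matrix ι κ F := Matrix.of fun a k => (c a)⁻¹ * f a k
  let B : Matrix κ ι F := Matrix.of fun k b => (c b)⁻¹ * g b k
  let N : Matrix ι ι F := Matrix.of fun a b => 1 - if a = b then 1 else 0
  have hAB : A * B = N := by
    ext a b
    have h : (A * B) a b = (c a)⁻¹ * (c b)⁻¹ * ∑ k, f a k * g b k := by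
      rw [Matrix.mul_apply, Finset.mul_sum]
      exact Finset.sum_congr rfl fun k _ => by simp only [A, B, Matrix.of_apply]; ring
    rw [h, hfg]
    have ha := hc a
    have hb := hc b
    by_cases hab : a = b
    · simp [N, hab]
    · simp only [N, hab, if_false, Matrix.of_apply]
      field_simp
      ring
  have hNN : N * N = 1 := by
    ext a b
    simp only [N, Matrix.mul_apply, Matrix.one_apply, Matrix.of_apply, sub_mul, mul_sub, one_mul, mul_one,
      Finset.sum_sub_distrib, ite_mul, zero_mul, Finset.sum_ite_eq, Finset.sum_ite_eq',
      Finset.sum_const, Finset.card_univ, nsmul_eq_mul, hcard, Finset.mem_univ, if_true]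
    ring
  have h1 : N * A * B = 1 := by rw [Matrix.mul_assoc, hAB, hNN]
  calc Fintype.card ι = (1 : Matrix ι ι F).rank := Matrix.rank_one.symm
    _ = (N * A * B).rank := by rw [h1]
    _ ≤ B.rank := Matrix.rank_mul_le_right _ _
    _ ≤ Fintype.card κ := Matrix.rank_le_card_height _

/-- The polar form of the hyperbolic quadric in dimension six. -/
def hyperbolicForm {F : Type*} [Field F] (x y : Fin 6 → F) : F :=
  x 0 * y 1 + x 1 * y 0 + x 2 * y 3 + x 3 * y 2 + x 4 * y 5 + x 5 * y 4

/-- Quadratic monomials spanning the degree two functions on the hyperbolic quadric,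
modulo the radical that appears in characteristic three. -/
def quadricMonomials {F : Type*} [Field F] (x : Fin 6 → F) : Fin 19 → F :=
  ![x 0 * x 0, x 1 * x 1, x 2 * x 2, x 3 * x 3, x 4 * x 4, x 5 * x 5,
    x 0 * x 2, x 0 * x 3, x 0 * x 4, x 0 * x 5, x 1 * x 2, x 1 * x 3, x 1 * x 4, x 1 * x 5,
    x 2 * x 4, x 2 * x 5, x 3 * x 4, x 3 * x 5, x 0 * x 1 - x 2 * x 3]

/-- The functions dual to `quadricMonomials` with respect to the squared polar form. -/
def quadricDualMonomials {F : Type*} [Field F] (x : Fin 6 → F) : Fin 19 → F :=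
  ![x 1 * x 1, x 0 * x 0, x 3 * x 3, x 2 * x 2, x 5 * x 5, x 4 * x 4,
    2 * (x 1 * x 3), 2 * (x 1 * x 2), 2 * (x 1 * x 5), 2 * (x 1 * x 4),
    2 * (x 0 * x 3), 2 * (x 0 * x 2), 2 * (x 0 * x 5), 2 * (x 0 * x 4),
    2 * (x 3 * x 5), 2 * (x 3 * x 4), 2 * (x 2 * x 5), 2 * (x 2 * x 4),
    x 0 * x 1 - x 2 * x 3]

theorem hyperbolicForm_sq {F : Type*} [Field F] [CharP F 3] (x y : Fin 6 → F)
    (hx : x 0 * x 1 + x 2 * x 3 + x 4 * x 5 = 0) (hy : y 0 * y 1 + y 2 * y 3 + y 4 * y 5 = 0) :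
    hyperbolicForm x y ^ 2 = ∑ k, quadricMonomials x k * quadricDualMonomials y k := by
  have h3 : (3 : F) = 0 := by exact_mod_cast CharP.cast_eq_zero F 3
  have hx' : x 4 * x 5 = -(x 0 * x 1) - x 2 * x 3 := by linear_combination hx
  have hy' : y 4 * y 5 = -(y 0 * y 1) - y 2 * y 3 := by linear_combination hy
  have hxy : (x 4 * x 5) * (y 4 * y 5) =
      (-(x 0 * x 1) - x 2 * x 3) * (-(y 0 * y 1) - y 2 * y 3) := by rw [hx', hy']
  simp only [hyperbolicForm, quadricMonomials, quadricDualMonomials, Fin.sum_univ_succ,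
    Matrix.cons_val_zero, Matrix.cons_val_succ, Finset.univ_eq_empty, Finset.sum_empty]
  linear_combination 2 * hxy +
    (x 0 * x 1 + x 2 * x 3) * (y 0 * y 1 + y 2 * y 3) * h3

theorem two_mul_sum_three_pow (t : ℕ) : ∑ i : Fin t, 2 * 3 ^ (i : ℕ) = 3 ^ t - 1 := by
  rw [Fin.sum_univ_eq_sum_range (fun i => 2 * 3 ^ i)]
  induction t with
  | zero => rfl
  | succ t ih =>
    rw [Finset.sum_range_succ, ih, pow_succ]
    have := Nat.one_le_pow t 3 (by norm_num)
    omega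

theorem hyperbolicForm_pow {F : Type*} [Field F] [CharP F 3] (t : ℕ) (x y : Fin 6 → F)
    (hx : x 0 * x 1 + x 2 * x 3 + x 4 * x 5 = 0) (hy : y 0 * y 1 + y 2 * y 3 + y 4 * y 5 = 0) :
    hyperbolicForm x y ^ (3 ^ t - 1) = ∑ k : Fin t → Fin 19,
      (∏ i, quadricMonomials x (k i) ^ 3 ^ (i : ℕ)) *
        ∏ i, quadricDualMonomials y (k i) ^ 3 ^ (i : ℕ) := by
  rw [← two_mul_sum_three_pow, ← Finset.prod_pow_eq_pow_sum]
  simp_rw [pow_mul, hyperbolicForm_sq x y hx hy, sum_pow_char_pow, Finset.prod_univ_sum,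
    Fintype.piFinset_univ, mul_pow, Finset.prod_mul_distrib]

/-- A partial ovoid of the elliptic quadric cut out of the hyperbolic quadric by a semilinear
polarity of order `3 ^ t` has size at most `19 ^ t`, provided its size is `2` in the field. -/
theorem card_le_of_hyperbolicForm_ne_zero {F ι : Type*} [Field F] [CharP F 3] [Fintype ι] (t : ℕ)
    (ht : 1 ≤ t) (P : ι → Fin 6 → F)
    (hP : ∀ a, P a 0 * P a 1 + P a 2 * P a 3 + P a 4 * P a 5 = 0)
    (hne : ∀ a b, a ≠ b → hyperbolicForm (P a) (P b) ≠ 0)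
    (c : ι → F) (hc : ∀ a, c a ≠ 0)
    (hPc : ∀ a i, P a i ^ 3 ^ t = c a * P a (![1, 0, 3, 2, 5, 4] i))
    (hcard : (Fintype.card ι : F) = 2) : Fintype.card ι ≤ 19 ^ t := by
  classical
  have h31 : 1 < 3 ^ t := Nat.one_lt_pow (by omega) (by norm_num)
  have hfrob : ∀ a b, hyperbolicForm (P a) (P b) ^ 3 ^ t =
      c a * c b * hyperbolicForm (P a) (P b) := by
    intro a b
    have h := fun x => hPc x
    simp only [Fin.forall_fin_succ] at h
    simp at h
    simp only [hyperbolicForm, add_pow_char_pow, mul_pow, h]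
    ring
  have key := card_le_of_factorization_off_diagonal c hc
    (fun a (k : Fin t → Fin 19) => ∏ i, quadricMonomials (P a) (k i) ^ 3 ^ (i : ℕ))
    (fun b k => ∏ i, quadricDualMonomials (P b) (k i) ^ 3 ^ (i : ℕ)) (fun a b => by
      rw [← hyperbolicForm_pow t _ _ (hP a) (hP b)]
      split_ifs with hab
      · subst hab
        rw [pow_eq_zero_iff (by omega), hyperbolicForm]
        linear_combination 2 * hP a
      · refine mul_right_cancel₀ (hne a b hab) ?_
        rw [← hfrob, ← pow_succ, Nat.sub_add_cancel h31.le]) hcard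
  simpa using key

/-- The Plücker coordinates of the span of `u` and `v`, ordered so that the Klein quadric is
`x₀x₁ + x₂x₃ + x₄x₅ = 0`. -/
def pluckerVector {F : Type*} [Field F] (u v : Fin 4 → F) : Fin 6 → F :=
  ![u 0 * v 1 - u 1 * v 0, u 2 * v 3 - u 3 * v 2, u 0 * v 2 - u 2 * v 0,
    u 3 * v 1 - u 1 * v 3, u 0 * v 3 - u 3 * v 0, u 1 * v 2 - u 2 * v 1]

theorem pluckerVector_klein {F : Type*} [Field F] (u v : Fin 4 → F) :
    pluckerVector u v 0 * pluckerVector u v 1 + pluckerVector u v 2 * pluckerVector u v 3 +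
      pluckerVector u v 4 * pluckerVector u v 5 = 0 := by
  simp only [pluckerVector, Matrix.cons_val]
  ring

theorem hyperbolicForm_pluckerVector {F : Type*} [Field F] (u v w z : Fin 4 → F) :
    hyperbolicForm (pluckerVector u v) (pluckerVector w z) = (Matrix.of ![u, v, w, z]).det := by
  simp [hyperbolicForm, pluckerVector, Matrix.det_succ_row_zero, Fin.sum_univ_succ,
    Fin.succAbove]
  ring

theorem exists_eq_mul_of_mul_eq_mul {F ι : Type*} [Field F] (a b : ι → F)
    (h : ∀ i j, a i * b j = a j * b i) (hb : b ≠ 0) : ∃ c, ∀ i, a i = c * b i := by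
  obtain ⟨j, hj⟩ := Function.ne_iff.mp hb
  refine ⟨a j / b j, fun i => ?_⟩
  have hj' : b j ≠ 0 := hj
  field_simp
  exact h i j

theorem pluckerVector_ne_zero {F : Type*} [Field F] (u v : Fin 4 → F)
    (huv : LinearIndependent F ![u, v]) : pluckerVector u v ≠ 0 := by
  intro h0
  have hv : v ≠ 0 := huv.ne_zero 1
  have h := fun i => congrFun h0 i
  simp only [Fin.forall_fin_succ] at h
  simp [pluckerVector] at h
  obtain ⟨c, hc⟩ := exists_eq_mul_of_mul_eq_mul u v (by
    intro i j
    fin_cases i <;> fin_cases j <;> simp <;> grind) hv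
  have := (LinearIndependent.pair_iff.mp huv) 1 (-c) (by ext i; simp [hc i])
  simp at this

/-- The alternating matrix with prescribed Plücker coordinates. -/
def pluckerMatrix {F : Type*} [Field F] (p : Fin 6 → F) : Matrix (Fin 4) (Fin 4) F :=
  !![0, p 0, p 2, p 4; -p 0, 0, p 5, -p 3; -p 2, -p 5, 0, p 1; -p 4, p 3, -p 1, 0]

theorem pluckerMatrix_pluckerVector {F : Type*} [Field F] (u v : Fin 4 → F) (i j : Fin 4) :
    pluckerMatrix (pluckerVector u v) i j = u i * v j - u j * v i := by
  fin_cases i <;> fin_cases j <;> simp [pluckerMatrix, pluckerVector]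

theorem mul_dual_eq_mul_dual_of_pluckerMatrix_mul_eq_zero {F : Type*} [Field F] [CharP F 3]
    (p q : Fin 6 → F) (h : ∀ i k, ∑ j, pluckerMatrix p i j * pluckerMatrix q j k = 0)
    (i j : Fin 6) :
    q i * p (![1, 0, 3, 2, 5, 4] j) = q j * p (![1, 0, 3, 2, 5, 4] i) := by
  have h3 : (3 : F) = 0 := by exact_mod_cast CharP.cast_eq_zero F 3
  simp only [Fin.sum_univ_succ, Fin.forall_fin_succ] at h
  simp [pluckerMatrix] at h
  obtain ⟨⟨h00, h01, h02, h03⟩, ⟨h10, h11, h12, h13⟩, ⟨h20, h21, h22, h23⟩,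
    h30, h31, h32, h33⟩ := h
  have d0 : p 0 * q 0 = p 1 * q 1 := by
    linear_combination h00 + h11 - h22 - h33 + (p 0 * q 0 - p 1 * q 1) * h3
  have d2 : p 2 * q 2 = p 3 * q 3 := by
    linear_combination h00 - h11 + h22 - h33 + (p 2 * q 2 - p 3 * q 3) * h3
  have d4 : p 4 * q 4 = p 5 * q 5 := by
    linear_combination h00 - h11 - h22 + h33 + (p 4 * q 4 - p 5 * q 5) * h3
  clear h3 h00 h11 h22 h33
  fin_cases i <;> fin_cases j <;> simp <;> grind

/-- The semilinear map induced by the Hermitian form fixes the Plücker points of the totally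
isotropic lines. -/
theorem exists_pluckerVector_pow {F : Type*} [Field F] [CharP F 3] (t : ℕ) (u v : Fin 4 → F)
    (huv : LinearIndependent F ![u, v])
    (huu : ∑ i, u i * u i ^ 3 ^ t = 0) (huv' : ∑ i, u i * v i ^ 3 ^ t = 0)
    (hvu : ∑ i, v i * u i ^ 3 ^ t = 0) (hvv : ∑ i, v i * v i ^ 3 ^ t = 0) :
    ∃ c : F, c ≠ 0 ∧ ∀ i, pluckerVector u v i ^ 3 ^ t =
      c * pluckerVector u v (![1, 0, 3, 2, 5, 4] i) := by
  have hp := pluckerVector_ne_zero u v huv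
  have hfr : ∀ i, pluckerVector u v i ^ 3 ^ t =
      pluckerVector (fun j => u j ^ 3 ^ t) (fun j => v j ^ 3 ^ t) i := by
    intro i
    fin_cases i <;> simp [pluckerVector, sub_pow_char_pow, mul_pow]
  set U := fun j => u j ^ 3 ^ t with hU
  set V := fun j => v j ^ 3 ^ t with hV
  have hcontract : ∀ i k, ∑ j, (u i * v j - u j * v i) * (U j * V k - U k * V j) = 0 := by
    intro i k
    have h : ∑ j, (u i * v j - u j * v i) * (U j * V k - U k * V j) =
        u i * V k * (∑ j, v j * U j) - u i * U k * (∑ j, v j * V j)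
          - v i * V k * (∑ j, u j * U j) + v i * U k * (∑ j, u j * V j) := by
      simp only [Finset.mul_sum, ← Finset.sum_sub_distrib, ← Finset.sum_add_distrib]
      exact Finset.sum_congr rfl fun j _ => by ring
    rw [h, huu, huv', hvu, hvv]
    ring
  obtain ⟨c, hc⟩ := exists_eq_mul_of_mul_eq_mul (fun i => pluckerVector u v i ^ 3 ^ t)
    (fun i => pluckerVector u v (![1, 0, 3, 2, 5, 4] i)) (by
      simp only [hfr]
      exact mul_dual_eq_mul_dual_of_pluckerMatrix_mul_eq_zero _ _ fun i k => by
        simpa only [pluckerMatrix_pluckerVector] using hcontract i k) (by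
    intro h
    apply hp
    have h := fun i => congrFun h i
    simp only [Fin.forall_fin_succ] at h
    simp at h
    ext i
    fin_cases i <;> simp [h])
  refine ⟨c, ?_, hc⟩
  rintro rfl
  exact hp (funext fun i => by simpa using hc i)

theorem det_ne_zero_of_inf_eq_bot {F : Type*} [Field F] (A B : Submodule F (Fin 4 → F))
    (hAB : A ⊓ B = ⊥) (u v w z : Fin 4 → F) (hu : u ∈ A) (hv : v ∈ A) (hw : w ∈ B) (hz : z ∈ B)
    (huv : LinearIndependent F ![u, v]) (hwz : LinearIndependent F ![w, z]) :
    (Matrix.of ![u, v, w, z]).det ≠ 0 := by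
  rw [← isUnit_iff_ne_zero, ← Matrix.isUnit_iff_isUnit_det,
    ← Matrix.linearIndependent_rows_iff_isUnit]
  rw [Fintype.linearIndependent_iff]
  intro g hg
  simp only [Fin.sum_univ_four] at hg
  have hg' : g 0 • u + g 1 • v + g 2 • w + g 3 • z = 0 := hg
  have h1 : g 0 • u + g 1 • v = -(g 2 • w + g 3 • z) := by
    rw [eq_neg_iff_add_eq_zero, ← hg']; abel
  have hA : g 0 • u + g 1 • v ∈ A := A.add_mem (A.smul_mem _ hu) (A.smul_mem _ hv)
  have hB : g 0 • u + g 1 • v ∈ B := by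
    rw [h1]; exact B.neg_mem (B.add_mem (B.smul_mem _ hw) (B.smul_mem _ hz))
  have h0 : g 0 • u + g 1 • v = 0 := by
    have : g 0 • u + g 1 • v ∈ A ⊓ B := ⟨hA, hB⟩
    rwa [hAB, Submodule.mem_bot] at this
  have h0' : g 2 • w + g 3 • z = 0 := by rw [h0] at h1; exact neg_eq_zero.mp h1.symm
  obtain ⟨ha, hb⟩ := LinearIndependent.pair_iff.mp huv _ _ h0
  obtain ⟨hc, hd⟩ := LinearIndependent.pair_iff.mp hwz _ _ h0'
  intro i
  fin_cases i <;> assumption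

theorem exists_linearIndependent_pair_mem {F V : Type*} [Field F] [AddCommGroup V] [Module F V]
    (W : Submodule F V) (hW : Module.finrank F W = 2) :
    ∃ u ∈ W, ∃ v ∈ W, LinearIndependent F ![u, v] := by
  have : Module.Finite F W := Module.finite_of_finrank_eq_succ hW
  let b := Module.finBasisOfFinrankEq F W hW
  refine ⟨b 0, (b 0).2, b 1, (b 1).2, ?_⟩
  have h := b.linearIndependent.map' W.subtype W.ker_subtype
  have hb : ![(b 0 : V), b 1] = W.subtype ∘ b := by
    ext i
    fin_cases i <;> rfl
  rwa [hb]

/-- Theorem 1(b): a partial spread `Y` of the Hermitian polar space `H(3, q²)`, `q = 3ᵗ`,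
satisfies `|Y| ≤ 19ᵗ`. -/
theorem partial_spread_H3_char_three_bound (t : ℕ) (ht : 1 ≤ t)
    (F : Type) [Field F] [Fintype F] (hF : Fintype.card F = (3 ^ t) ^ 2)
    (Y : Finset (Submodule F (Fin 4 → F)))
    (hgen : ∀ W ∈ Y, Module.finrank F W = 2 ∧
      ∀ x ∈ W, ∀ y ∈ W, ∑ i, x i * y i ^ (3 ^ t) = 0)
    (hspread : ∀ a ∈ Y, ∀ b ∈ Y, a ≠ b → a ⊓ b = ⊥) :
    Y.card ≤ 19 ^ t := by
  have : Fact (Nat.Prime 3) := ⟨Nat.prime_three⟩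
  have hchar : CharP F 3 := charP_of_card_eq_prime_pow (f := t * 2) (by rw [hF, pow_mul])
  by_contra! hlt
  obtain ⟨S, hSY, hS⟩ := Finset.exists_subset_card_eq (Nat.succ_le_of_lt hlt)
  have hex : ∀ a : S, ∃ u ∈ a.1, ∃ v ∈ a.1, LinearIndependent F ![u, v] := fun a =>
    exists_linearIndependent_pair_mem a.1 (hgen _ (hSY a.2)).1
  choose u hu v hv huv using hex
  have hiso := fun a : S => (hgen _ (hSY a.2)).2
  have hc := fun a : S => exists_pluckerVector_pow t (u a) (v a) (huv a)
    (hiso a _ (hu a) _ (hu a)) (hiso a _ (hu a) _ (hv a)) (hiso a _ (hv a) _ (hu a))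
    (hiso a _ (hv a) _ (hv a))
  choose c hc0 hc using hc
  have h := card_le_of_hyperbolicForm_ne_zero t ht (fun a : S => pluckerVector (u a) (v a))
    (fun a => pluckerVector_klein _ _) (fun a b hab => by
      rw [hyperbolicForm_pluckerVector]
      exact det_ne_zero_of_inf_eq_bot a.1 b.1
        (hspread _ (hSY a.2) _ (hSY b.2) fun h => hab (Subtype.ext h)) _ _ _ _
        (hu a) (hv a) (hu b) (hv b) (huv a) (huv b)) c hc0 hc (by
      have h19 : (19 : F) = 1 := by
        have h3 : (3 : F) = 0 := by exact_mod_cast CharP.cast_eq_zero F 3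
        linear_combination 6 * h3
      rw [Fintype.card_coe, hS]
      push_cast
      rw [h19]
      norm_num)
  rw [Fintype.card_coe, hS] at h
  omega
end

section
/- Let p be a prime, t ≥ 1, q = p^t, and let d > 2 be even. Every partial spread Y of the Hermitian polar space H(2d-1, q^2) satisfies |Y| ≤ (p^{2d-1} - p·(p^{2d-2} - 1)/(p + 1))^t + 1. -/
open Finset
open scoped Matrix

/-- The number of pairs with a prescribed weight difference is largest for difference zero. -/
theorem card_diff_eq_lt {A : Type*} [Fintype A] [Nonempty A] (w : A → ℤ) {k : ℤ} (hk : k ≠ 0) :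
    #{x : A × A | w x.1 = w x.2 + k} < #{x : A × A | w x.1 = w x.2} := by
  classical
  let S : Finset ℤ := univ.image w
  let n : ℤ → ℕ := fun s => #{a : A | w a = s}
  have hcount (l : ℤ) : #{x : A × A | w x.1 = w x.2 + l} = ∑ s ∈ S, n (s + l) * n s := by
    rw [card_eq_sum_card_fiberwise (f := fun x : A × A => w x.2) (t := S)
      (fun x _ => mem_image_of_mem _ (mem_univ _))]
    refine sum_congr rfl fun s _ => ?_
    rw [← card_product]
    congr 1
    ext x
    simp only [mem_filter, mem_univ, true_and, mem_product]
    constructor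
    · rintro ⟨h, rfl⟩
      exact ⟨h, rfl⟩
    · rintro ⟨h, rfl⟩
      exact ⟨h, rfl⟩
  have hzero : ∀ s, s ∉ S → n s = 0 := by
    intro s hs
    simp only [n, card_eq_zero, filter_eq_empty_iff]
    exact fun a _ ha => hs (ha ▸ mem_image_of_mem _ (mem_univ _))
  have hpos : ∀ s ∈ S, 0 < n s := by
    intro s hs
    obtain ⟨a, -, rfl⟩ := mem_image.1 hs
    exact card_pos.2 ⟨a, by simp⟩
  have hS : S.Nonempty := univ_nonempty.image w
  obtain ⟨s₀, hs₀, hs₀'⟩ : ∃ s ∈ S, s + k ∉ S := by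
    rcases lt_or_gt_of_ne hk with h | h
    · refine ⟨S.min' hS, S.min'_mem hS, fun hm => ?_⟩
      have := S.min'_le _ hm
      omega
    · refine ⟨S.max' hS, S.max'_mem hS, fun hm => ?_⟩
      have := S.le_max' _ hm
      omega
  have hshift : ∑ s ∈ S, n (s + k) ^ 2 ≤ ∑ s ∈ S, n s ^ 2 := by
    calc ∑ s ∈ S, n (s + k) ^ 2 = ∑ s ∈ S.map (addRightEmbedding k), n s ^ 2 := by
          simp [sum_map]
      _ ≤ ∑ s ∈ S, n s ^ 2 := by
          apply sum_le_sum_of_ne_zero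
          intro s _ h
          by_contra hs
          simp [hzero s hs] at h
  have hlt : ∑ s ∈ S, 2 * (n (s + k) * n s) < ∑ s ∈ S, (n (s + k) ^ 2 + n s ^ 2) := by
    refine sum_lt_sum (fun s _ => ?_) ⟨s₀, hs₀, ?_⟩
    · have := two_mul_le_add_sq (n (s + k)) (n s)
      linarith
    · have := hpos _ hs₀
      rw [hzero _ hs₀']
      nlinarith [pow_pos this 2]
  have h0 := hcount 0
  simp only [add_zero] at h0
  rw [hcount k, h0]
  rw [sum_add_distrib, ← mul_sum] at hlt
  have : ∑ s ∈ S, n s * n s = ∑ s ∈ S, n s ^ 2 := sum_congr rfl fun s _ => (sq _).symm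
  omega

theorem succ_mul_card_sum_eq_le (p d : ℕ) (hp : 0 < p) :
    (p + 1) * #{x : (Fin d → Fin p) × (Fin d → Fin p) |
      ∑ i, ((x.1 i : ℕ) : ℤ) = ∑ i, ((x.2 i : ℕ) : ℤ)} ≤ p ^ (2 * d) + p := by
  have : NeZero p := ⟨hp.ne'⟩
  induction d with
  | zero => simp [add_comm]
  | succ d ih =>
    set c := #{x : (Fin d → Fin p) × (Fin d → Fin p) |
      ∑ i, ((x.1 i : ℕ) : ℤ) = ∑ i, ((x.2 i : ℕ) : ℤ)} with hc
    have key : #{x : (Fin (d + 1) → Fin p) × (Fin (d + 1) → Fin p) |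
        ∑ i, ((x.1 i : ℕ) : ℤ) = ∑ i, ((x.2 i : ℕ) : ℤ)} ≤
        ∑ y : Fin p × Fin p, (if y.1 = y.2 then c else c - 1) := by
      rw [card_eq_sum_card_fiberwise (t := univ)
        (f := fun x : (Fin (d + 1) → Fin p) × (Fin (d + 1) → Fin p) => (x.1 0, x.2 0))
        (fun _ _ => mem_coe.2 (mem_univ _))]
      refine sum_le_sum fun y _ => ?_
      have hle : #{x ∈ ({x : (Fin (d + 1) → Fin p) × (Fin (d + 1) → Fin p) |
          ∑ i, ((x.1 i : ℕ) : ℤ) = ∑ i, ((x.2 i : ℕ) : ℤ)} : Finset _) | (x.1 0, x.2 0) = y} ≤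
          #{x : (Fin d → Fin p) × (Fin d → Fin p) |
            ∑ i, ((x.1 i : ℕ) : ℤ) = ∑ i, ((x.2 i : ℕ) : ℤ) + ((y.2 : ℕ) - (y.1 : ℕ) : ℤ)} := by
        refine card_le_card_of_injOn (fun x => (Fin.tail x.1, Fin.tail x.2)) ?_ ?_
        · intro x hx
          simp only [coe_filter, mem_filter, mem_univ, true_and, Set.mem_ofPred_eq] at hx ⊢
          obtain ⟨h, rfl⟩ := hx
          rw [Fin.sum_univ_succ, Fin.sum_univ_succ] at h
          simp only [Fin.tail]
          linarith
        · intro x hx x' hx' h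
          simp only [coe_filter, mem_filter, mem_univ, true_and, Set.mem_ofPred_eq] at hx hx'
          obtain ⟨-, rfl⟩ := hx
          obtain ⟨-, hx'⟩ := hx'
          simp only [Prod.mk.injEq] at h hx'
          ext1
          · rw [← Fin.cons_self_tail x.1, ← Fin.cons_self_tail x'.1, h.1, hx'.1]
          · rw [← Fin.cons_self_tail x.2, ← Fin.cons_self_tail x'.2, h.2, hx'.2]
      refine hle.trans ?_
      split_ifs with h
      · rw [h]
        simp [hc]
      · refine Nat.le_sub_one_of_lt (card_diff_eq_lt
          (fun u : Fin d → Fin p => ∑ i, ((u i : ℕ) : ℤ)) ?_)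
        intro h0
        exact h (Fin.ext (by omega))
    have hsum : ∑ y : Fin p × Fin p, (if y.1 = y.2 then c else c - 1) =
        p * (c + (p - 1) * (c - 1)) := by
      rw [Fintype.sum_prod_type]
      have : ∀ i : Fin p, ∑ j : Fin p, (if i = j then c else c - 1) = c + (p - 1) * (c - 1) := by
        intro i
        rw [← add_sum_erase _ _ (mem_univ i), if_pos rfl]
        congr 1
        rw [sum_congr rfl (g := fun _ => c - 1)]
        · simp
        · intro j hj
          rw [if_neg (ne_of_mem_erase hj).symm]
      simp [this]
    rw [hsum] at key
    have hcpos : 0 < c := card_pos.2 ⟨(0, 0), by simp⟩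
    obtain ⟨c', hc'⟩ : ∃ c', c = c' + 1 := ⟨c - 1, by omega⟩
    obtain ⟨r, rfl⟩ : ∃ r, p = r + 1 := ⟨p - 1, by omega⟩
    rw [hc'] at key ih
    simp only [Nat.add_sub_cancel] at key
    calc _ ≤ (r + 1 + 1) * ((r + 1) * (c' + 1 + r * c')) := Nat.mul_le_mul_left _ key
      _ ≤ _ := by
        have := Nat.mul_le_mul_left ((r + 1) ^ 2) ih
        rw [show 2 * (d + 1) = 2 * d + 2 by ring, pow_add]
        nlinarith

theorem card_sum_eq_le (p d : ℕ) (hp : 0 < p) (hd : 0 < d) {n : Type*} [Fintype n] [DecidableEq n]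
    (hn : Fintype.card n = 2 * d) :
    Fintype.card {e : n → Fin p // ∑ j, (e j : ℕ) = d * (p - 1)} ≤
      p ^ (2 * d - 1) - p * ((p ^ (2 * d - 2) - 1) / (p + 1)) := by
  obtain ⟨f⟩ : Nonempty (n ≃ Fin d ⊕ Fin d) :=
    ⟨Fintype.equivOfCardEq (by simp [hn, two_mul])⟩
  have hle : Fintype.card {e : n → Fin p // ∑ j, (e j : ℕ) = d * (p - 1)} ≤
      #{x : (Fin d → Fin p) × (Fin d → Fin p) |
        ∑ i, ((x.1 i : ℕ) : ℤ) = ∑ i, ((x.2 i : ℕ) : ℤ)} := by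
    rw [Fintype.card_subtype]
    refine card_le_card_of_injOn
      (fun e => (fun i => e (f.symm (.inl i)), fun i => (e (f.symm (.inr i))).rev)) ?_ ?_
    · intro e he
      simp only [coe_filter, mem_univ, true_and, Set.mem_ofPred_eq] at he ⊢
      rw [← f.symm.sum_comp, Fintype.sum_sum_type] at he
      have h2 : ∑ i, (((e (f.symm (.inr i))).rev : ℕ) : ℤ) =
          d * ((p : ℤ) - 1) - ∑ i, ((e (f.symm (.inr i)) : ℕ) : ℤ) := by
        have : ∀ i, (((e (f.symm (.inr i))).rev : ℕ) : ℤ) =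
            ((p : ℤ) - 1) - ((e (f.symm (.inr i)) : ℕ) : ℤ) := by
          intro i
          rw [Fin.val_rev]
          omega
        rw [sum_congr rfl fun i _ => this i, sum_sub_distrib]
        simp [mul_sub]
      rw [h2]
      zify [hp] at he
      linarith
    · intro e _ e' _ h
      simp only [Prod.mk.injEq, funext_iff, Fin.rev_inj] at h
      funext j
      obtain ⟨k, rfl⟩ := f.symm.surjective j
      cases k with
      | inl i => exact h.1 i
      | inr i => exact h.2 i
  have hb := succ_mul_card_sum_eq_le p d hp
  obtain ⟨k, rfl⟩ : ∃ k, d = k + 1 := ⟨d - 1, by omega⟩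
  obtain ⟨m, hm⟩ : p + 1 ∣ p ^ (2 * k) - 1 := by
    have h : ((p : ℤ) + 1) ∣ (p : ℤ) ^ (2 * k) - 1 := by
      have := sub_dvd_pow_sub_pow ((p : ℤ) ^ 2) 1 k
      rw [one_pow, ← pow_mul] at this
      exact (Dvd.intro ((p : ℤ) - 1) (by ring)).trans this
    zify [Nat.one_le_pow (2 * k) p hp]
    exact h
  have hm' : p ^ (2 * k) = 1 + (p + 1) * m := by
    have := Nat.one_le_pow (2 * k) p hp
    omega
  rw [show 2 * (k + 1) - 2 = 2 * k by omega, show 2 * (k + 1) - 1 = 2 * k + 1 by omega, hm,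
    Nat.mul_div_cancel_left _ (by omega), pow_succ, hm']
  rw [show 2 * (k + 1) = 2 * k + 2 by omega, pow_add, hm'] at hb
  refine hle.trans (Nat.le_sub_of_add_le ?_)
  have h3 := Nat.le_of_mul_le_mul_left (hb.trans_eq (show _ = (p + 1) * (p + p ^ 2 * m) by ring))
    (by omega)
  nlinarith

section

open MvPolynomial

section

variable {K m n l : Type*} [CommRing K] [Fintype m] [Fintype n] [Fintype l]

/-- The linear form whose coefficients are the `i`-th row of `M`. -/
noncomputable def rowForm (M : Matrix m n K) (i : m) : MvPolynomial n K :=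
  ∑ j, C (M i j) * X j

/-- The product of the `(p - 1)`-st powers of the linear forms given by the rows of `M`. -/
noncomputable def rowPowProd (p : ℕ) (M : Matrix m n K) : MvPolynomial n K :=
  ∏ i, rowForm M i ^ (p - 1)

/-- The exponent of the monomial `∏ j, X j ^ (p - 1)`. -/
noncomputable def topExp (p : ℕ) (n : Type*) [Fintype n] : n →₀ ℕ :=
  Finsupp.equivFunOnFinite.symm fun _ => p - 1

theorem aeval_rowForm_rowPowProd (p : ℕ) (M : Matrix m n K) (N : Matrix n l K) :
    aeval (rowForm N) (rowPowProd p M) = rowPowProd p (M * N) := by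
  simp only [rowPowProd, map_prod, map_pow]
  refine prod_congr rfl fun i _ => ?_
  congr 1
  simp only [rowForm, map_sum, map_mul, aeval_X, algHom_C, algebraMap_eq, Matrix.mul_apply,
    mul_sum, sum_mul, mul_assoc]
  rw [sum_comm]

theorem isHomogeneous_rowPowProd (p : ℕ) (M : Matrix m n K) :
    (rowPowProd p M).IsHomogeneous (Fintype.card m * (p - 1)) := by
  have h := IsHomogeneous.prod univ (fun i => rowForm M i ^ (p - 1)) (fun _ => 1 * (p - 1))
    fun i _ => (IsHomogeneous.sum _ _ 1 fun j _ => by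
      simpa using (isHomogeneous_C n (M i j)).mul (isHomogeneous_X K j)).pow (p - 1)
  simpa [rowPowProd] using h

theorem coeff_topExp_X_pow_mul {p : ℕ} (hp : 0 < p) (j : n) (f : MvPolynomial n K) :
    coeff (topExp p n) (X j ^ p * f) = 0 := by
  rw [X_pow_eq_monomial, coeff_monomial_mul', if_neg]
  intro h
  have := h j
  simp [topExp] at this
  omega

omit [Fintype m] in
theorem coeff_topExp_rowForm_pow_mul (p : ℕ) [Fact p.Prime] [CharP K p] (N : Matrix m n K)
    (i : m) (f : MvPolynomial n K) : coeff (topExp p n) (rowForm N i ^ p * f) = 0 := by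
  have hp := (Fact.out : p.Prime).pos
  rw [rowForm, sum_pow_char, sum_mul, coeff_sum]
  refine sum_eq_zero fun j _ => ?_
  rw [mul_pow, mul_assoc, ← map_pow, coeff_C_mul, coeff_topExp_X_pow_mul hp, mul_zero]

theorem coeff_topExp_rowPowProd_mul [DecidableEq n] (p : ℕ) [Fact p.Prime] [CharP K p]
    (M : Matrix m n K) (N : Matrix n l K) :
    coeff (topExp p l) (rowPowProd p (M * N)) =
      ∑ e : {e : n → Fin p // ∑ j, (e j : ℕ) = Fintype.card m * (p - 1)},
        coeff (Finsupp.equivFunOnFinite.symm fun j => (e.1 j : ℕ)) (rowPowProd p M) *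
          coeff (topExp p l) (∏ j, rowForm N j ^ (e.1 j : ℕ)) := by
  classical
  let F : (n →₀ ℕ) → K := fun e =>
    coeff e (rowPowProd p M) * coeff (topExp p l) (∏ j, rowForm N j ^ e j)
  let ι : {e : n → Fin p // ∑ j, (e j : ℕ) = Fintype.card m * (p - 1)} ↪ (n →₀ ℕ) :=
    ⟨fun e => Finsupp.equivFunOnFinite.symm fun j => (e.1 j : ℕ), fun e e' h => by
      ext j
      exact DFunLike.congr_fun h j⟩
  have hR : ∑ e ∈ univ.map ι, F e = ∑ e, F (ι e) := sum_map _ _ _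
  refine Eq.trans ?_ hR
  rw [← aeval_rowForm_rowPowProd, aeval_def, eval₂_eq', coeff_sum]
  simp only [algebraMap_eq, coeff_C_mul]
  refine sum_congr_of_eq_on_inter (fun e he he' => ?_) (fun e _ he => ?_) (fun _ _ _ => rfl)
  · have hdeg : ∑ j, e j = Fintype.card m * (p - 1) := by
      rw [← isHomogeneous_rowPowProd p M (mem_support_iff.1 he), Finsupp.weight_apply,
        Finsupp.sum_fintype _ _ (by simp)]
      simp
    obtain ⟨j, hj⟩ : ∃ j, p ≤ e j := by
      by_contra! h
      exact he' (mem_map.2 ⟨⟨fun j => ⟨e j, h j⟩, hdeg⟩, mem_univ _, by ext; rfl⟩)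
    rw [← mul_prod_erase _ _ (mem_univ j), ← Nat.add_sub_of_le hj, pow_add, mul_assoc,
      coeff_topExp_rowForm_pow_mul, mul_zero]
  · simp [F, notMem_support_iff.1 he]

end

section

variable {K n : Type*} [Fintype n]

theorem coeff_topExp_rowPowProd_mul_square [CommRing K] [DecidableEq n] (p : ℕ) [Fact p.Prime] [CharP K p]
    (M N : Matrix n n K) :
    coeff (topExp p n) (rowPowProd p (M * N)) =
      coeff (topExp p n) (rowPowProd p M) * coeff (topExp p n) (rowPowProd p N) := by
  have hp := (Fact.out : p.Prime).pos
  rw [coeff_topExp_rowPowProd_mul]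
  rw [Fintype.sum_eq_single ⟨fun _ => ⟨p - 1, by omega⟩, by simp⟩]
  · rfl
  · intro e he
    refine absurd (Subtype.ext (funext fun j => Fin.ext ?_)) he
    have h : ∑ j, (e.1 j : ℕ) = ∑ j : n, (p - 1) := by rw [e.2]; simp
    exact (sum_eq_sum_iff_of_le fun j _ => by have := (e.1 j).2; omega).1 h j (mem_univ j)

/-- In characteristic `p`, the coefficient of `∏ j, X j ^ (p - 1)` in the product of the
`(p - 1)`-st powers of the rows of `M` is `M.det ^ (p - 1)`. -/
theorem coeff_topExp_rowPowProd [Field K] [DecidableEq n] (p : ℕ) [Fact p.Prime] [CharP K p]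
    (M : Matrix n n K) :
    coeff (topExp p n) (rowPowProd p M) = M.det ^ (p - 1) := by
  have hp := (Fact.out : p.Prime).pos
  have hX : ∏ i : n, (X i : MvPolynomial n K) ^ (p - 1) = monomial (topExp p n) 1 := by
    simp [monomial_eq, topExp, Finsupp.prod_fintype]
  induction M using Matrix.diagonal_transvection_induction with
  | hdiag D _ =>
    have : ∀ i, rowForm (Matrix.diagonal D) i = C (D i) * X i := by
      intro i
      simp [rowForm, Matrix.diagonal_apply, apply_ite C]
    simp only [rowPowProd, this, mul_pow, prod_mul_distrib, hX, ← map_pow, ← map_prod,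
      coeff_C_mul]
    simp [prod_pow]
  | htransvec t =>
    obtain ⟨i, j, hij, c⟩ := t
    have hne : ∀ k, k ≠ i → rowForm (Matrix.transvection i j c) k = X k := by
      intro k hk
      simp [rowForm, Matrix.transvection, Matrix.one_apply, hk.symm, apply_ite C]
    have hi : rowForm (Matrix.transvection i j c) i = X i + C c * X j := by
      simp [rowForm, Matrix.transvection, Matrix.one_apply, Matrix.single_apply, add_mul,
        sum_add_distrib, apply_ite C]
    obtain ⟨r, hr⟩ : (X j : MvPolynomial n K) ∣
        (X i + C c * X j) ^ (p - 1) - X i ^ (p - 1) := by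
      refine Dvd.dvd.trans ?_ (sub_dvd_pow_sub_pow _ _ _)
      simp
    have hprod : rowPowProd p (Matrix.transvection i j c) =
        ∏ k, X k ^ (p - 1) + X j ^ p * (r * ∏ k ∈ (univ.erase i).erase j, X k ^ (p - 1)) := by
      rw [rowPowProd, ← mul_prod_erase _ _ (mem_univ i), hi, eq_add_of_sub_eq' hr,
        prod_congr rfl fun k hk => by rw [hne k (ne_of_mem_erase hk)], add_mul,
        mul_prod_erase _ (fun k => (X k : MvPolynomial n K) ^ (p - 1)) (mem_univ i),
        ← mul_prod_erase (univ.erase i) _ (mem_erase.2 ⟨hij.symm, mem_univ j⟩)]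
      obtain ⟨s, rfl⟩ : ∃ s, p = s + 1 := ⟨p - 1, by omega⟩
      simp only [Nat.add_sub_cancel]
      ring
    change coeff _ (rowPowProd p (Matrix.transvection i j c)) =
      (Matrix.transvection i j c).det ^ (p - 1)
    rw [hprod, coeff_add, coeff_topExp_X_pow_mul hp, hX]
    simp [Matrix.det_transvection_of_ne _ _ hij]
  | hmul A B hA hB =>
    rw [coeff_topExp_rowPowProd_mul_square, hA, hB, Matrix.det_mul, mul_pow]

end

theorem exists_det_pow_eq_sum {K m n : Type*} [Field K] [Fintype m] [DecidableEq m] [Fintype n]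
    [DecidableEq n] (p t d : ℕ) [Fact p.Prime] [CharP K p] (hm : Fintype.card m = d) :
    ∃ φ ψ : (Fin t → {e : n → Fin p // ∑ j, (e j : ℕ) = d * (p - 1)}) →
        Matrix m n K → K,
      ∀ M N : Matrix m n K, (M * N.transpose).det ^ (p ^ t - 1) =
        ∑ e, φ e M * ψ e N := by
  subst hm
  have hp := (Fact.out : p.Prime).pos
  obtain ⟨φ, ψ, h⟩ : ∃ φ ψ : {e : n → Fin p // ∑ j, (e j : ℕ) = Fintype.card m * (p - 1)} →
        Matrix m n K → K, ∀ M N : Matrix m n K,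
      (M * N.transpose).det ^ (p - 1) = ∑ e, φ e M * ψ e N := by
    have h := fun M N : Matrix m n K => coeff_topExp_rowPowProd_mul p M N.transpose
    simp only [coeff_topExp_rowPowProd] at h
    exact ⟨fun e M => _, fun e N => _, h⟩
  refine ⟨fun e M => ∏ i, φ (e i) M ^ p ^ (i : ℕ), fun e N => ∏ i, ψ (e i) N ^ p ^ (i : ℕ),
    fun M N => ?_⟩
  have hgeom : p ^ t - 1 = ∑ i : Fin t, (p - 1) * p ^ (i : ℕ) := by
    obtain ⟨r, rfl⟩ : ∃ r, p = r + 1 := ⟨p - 1, by omega⟩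
    rw [Fin.sum_univ_eq_sum_range (fun i => (r + 1 - 1) * (r + 1) ^ i), ← mul_sum, mul_comm,
      Nat.add_sub_cancel, ← geom_sum_mul_add, Nat.add_sub_cancel]
  rw [hgeom, ← prod_pow_eq_pow_sum]
  simp only [pow_mul, h, sum_pow_char_pow, mul_pow, ← prod_mul_distrib]
  rw [prod_univ_sum, Fintype.piFinset_univ]

end

theorem card_le_succ_card_of_sum_mul_eq {K ι κ : Type*} [Field K] [Fintype ι] [DecidableEq ι]
    [Fintype κ] (φ ψ : κ → ι → K)
    (h : ∀ b c, ∑ e, φ e b * ψ e c = if b = c then 0 else 1) :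
    Fintype.card ι ≤ Fintype.card κ + 1 := by
  let A : Matrix ι (Option κ) K := Matrix.of fun b e => e.elim 1 fun e => -φ e b
  let B : Matrix (Option κ) ι K := Matrix.of fun e c => e.elim 1 fun e => ψ e c
  have hAB : A * B = 1 := by
    ext b c
    simp only [Matrix.mul_apply, Fintype.sum_option, A, B, Matrix.of_apply, Option.elim, neg_mul,
      sum_neg_distrib, h, Matrix.one_apply]
    split_ifs <;> simp
  calc Fintype.card ι = (1 : Matrix ι ι K).rank := Matrix.rank_one.symm
    _ ≤ A.rank := hAB ▸ Matrix.rank_mul_le_left A B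
    _ ≤ Fintype.card κ + 1 := by simpa using A.rank_le_card_width

section

variable {F n : Type*} [Field F] [Fintype n] {s : F →+* F} {a b c : Submodule F (n → F)}

theorem eq_zero_of_orthogonal [DecidableEq n] (hb : ∀ x ∈ b, ∀ y ∈ b, x ⬝ᵥ (s ∘ y) = 0)
    (hab : a ⊔ b = ⊤) {x : n → F} (hx : x ∈ b) (h : ∀ y ∈ a, x ⬝ᵥ (s ∘ y) = 0) : x = 0 := by
  ext i
  obtain ⟨y, hy, z, hz, hyz⟩ := Submodule.mem_sup.1
    (hab ▸ Submodule.mem_top : (Pi.single i 1 : n → F) ∈ a ⊔ b)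
  have h1 : s ∘ (Pi.single i 1 : n → F) = Pi.single i 1 := by
    ext j
    by_cases hj : j = i
    · subst hj
      simp
    · simp [hj]
  have h2 : x ⬝ᵥ (s ∘ (y + z)) = 0 := by
    rw [show s ∘ (y + z) = s ∘ y + s ∘ z from funext fun j => map_add s _ _,
      dotProduct_add, h y hy, hb x hx z hz, add_zero]
  rw [hyz, h1] at h2
  simpa using h2

theorem mem_of_orthogonal [DecidableEq n] (ha : ∀ x ∈ a, ∀ y ∈ a, x ⬝ᵥ (s ∘ y) = 0)
    (hb : ∀ x ∈ b, ∀ y ∈ b, x ⬝ᵥ (s ∘ y) = 0)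
    (hab : a ⊔ b = ⊤) {x : n → F} (h : ∀ y ∈ a, x ⬝ᵥ (s ∘ y) = 0) : x ∈ a := by
  obtain ⟨y, hy, z, hz, rfl⟩ := Submodule.mem_sup.1 (hab ▸ Submodule.mem_top : x ∈ a ⊔ b)
  have : z = 0 := eq_zero_of_orthogonal hb hab hz fun w hw => by
    simpa [add_dotProduct, ha y hy w hw] using h w hw
  simpa [this] using hy

/-- The rows of `M` form a basis of `W`. -/
structure IsRowBasis {m : Type*} [Fintype m] (M : Matrix m n F) (W : Submodule F (n → F)) :
    Prop where
  row_mem : ∀ i, M i ∈ W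
  exists_vecMul : ∀ y ∈ W, ∃ v, y = v ᵥ* M
  eq_zero_of_vecMul : ∀ v, v ᵥ* M = 0 → v = 0

theorem exists_isRowBasis {d : ℕ} (h : Module.finrank F a = d) :
    ∃ M : Matrix (Fin d) n F, IsRowBasis M a := by
  let B := Module.finBasisOfFinrankEq F a h
  have hv : ∀ v : Fin d → F,
      v ᵥ* (Matrix.of fun i => (B i : n → F)) = ((∑ i, v i • B i : a) : n → F) := by
    intro v
    rw [Matrix.vecMul_eq_sum]
    simp
    rfl
  refine ⟨Matrix.of fun i => (B i : n → F), fun i => (B i).2, fun y hy => ⟨B.repr ⟨y, hy⟩, ?_⟩,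
    fun v h0 => ?_⟩
  · rw [hv, B.sum_repr]
  · rw [hv, Submodule.coe_eq_zero] at h0
    exact funext (Fintype.linearIndependent_iff.1 B.linearIndependent v h0)

variable {m : Type*} [Fintype m] {M N : Matrix m n F}

omit [Fintype n] in
theorem IsRowBasis.vecMul_mem (hM : IsRowBasis M a) (v : m → F) : v ᵥ* M ∈ a := by
  rw [Matrix.vecMul_eq_sum]
  exact a.sum_mem fun i _ => a.smul_mem _ (hM.row_mem i)

omit [Fintype n] in
theorem IsRowBasis.mul [DecidableEq m] (hM : IsRowBasis M a) {U : Matrix m m F} (hU : U.det ≠ 0) :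
    IsRowBasis (U * M) a where
  row_mem i := hM.vecMul_mem (U i)
  exists_vecMul y hy := by
    obtain ⟨v, rfl⟩ := hM.exists_vecMul y hy
    refine ⟨v ᵥ* U⁻¹, ?_⟩
    rw [Matrix.vecMul_vecMul, Matrix.nonsing_inv_mul_cancel_left _ _ (isUnit_iff_ne_zero.2 hU)]
  eq_zero_of_vecMul v hv := by
    rw [← Matrix.vecMul_vecMul] at hv
    have := hM.eq_zero_of_vecMul _ hv
    by_contra h0
    exact hU (Matrix.exists_vecMul_eq_zero_iff.1 ⟨v, h0, this⟩)

theorem IsRowBasis.orthogonal_of_mul_eq_zero (hN : IsRowBasis N a) {x : n → F}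
    (h : x ᵥ* (N.map s)ᵀ = 0) : ∀ y ∈ a, x ⬝ᵥ (s ∘ y) = 0 := by
  intro y hy
  obtain ⟨v, rfl⟩ := hN.exists_vecMul y hy
  have : s ∘ (v ᵥ* N) = (N.map s)ᵀ *ᵥ (s ∘ v) := by
    rw [Matrix.mulVec_transpose]
    ext j
    simp [Matrix.vecMul, dotProduct]
  rw [this, Matrix.dotProduct_mulVec, h, zero_dotProduct]

theorem IsRowBasis.det_gram_ne_zero [DecidableEq m] [DecidableEq n] (hM : IsRowBasis M b)
    (hN : IsRowBasis N a) (hb : ∀ x ∈ b, ∀ y ∈ b, x ⬝ᵥ (s ∘ y) = 0) (hab : a ⊔ b = ⊤) :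
    (M * (N.map s)ᵀ).det ≠ 0 := by
  intro h
  obtain ⟨v, hv, hv'⟩ := Matrix.exists_vecMul_eq_zero_iff.2 h
  rw [← Matrix.vecMul_vecMul] at hv'
  exact hv (hM.eq_zero_of_vecMul v (eq_zero_of_orthogonal hb hab (hM.vecMul_mem v)
    (hN.orthogonal_of_mul_eq_zero hv')))

omit [Fintype m] in
theorem gram_eq_zero (ha : ∀ x ∈ a, ∀ y ∈ a, x ⬝ᵥ (s ∘ y) = 0) (hM : ∀ i, M i ∈ a) :
    M * (M.map s)ᵀ = 0 := by
  ext i j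
  exact ha _ (hM i) _ (hM j)

omit [Fintype m] in
theorem gram_map_transpose (hs : ∀ x, s (s x) = x) :
    ((M * (N.map s)ᵀ).map s)ᵀ = N * (M.map s)ᵀ := by
  ext i j
  simp [Matrix.mul_apply, hs, mul_comm]

theorem gram_swap_eq_neg [DecidableEq m] [DecidableEq n] {A : Matrix m n F}
    (ha : ∀ x ∈ a, ∀ y ∈ a, x ⬝ᵥ (s ∘ y) = 0)
    (hb : ∀ x ∈ b, ∀ y ∈ b, x ⬝ᵥ (s ∘ y) = 0) (hc : ∀ x ∈ c, ∀ y ∈ c, x ⬝ᵥ (s ∘ y) = 0)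
    (hab : a ⊔ b = ⊤) (hA : IsRowBasis A a) (hM : ∀ i, M i ∈ b) (hN : ∀ i, N i ∈ c)
    (hMA : M * (A.map s)ᵀ = 1) (hNA : N * (A.map s)ᵀ = 1) :
    N * (M.map s)ᵀ = -(M * (N.map s)ᵀ) := by
  have h0 : (M - N) * (A.map s)ᵀ = 0 := by rw [Matrix.sub_mul, hMA, hNA, sub_self]
  have hmem : ∀ i, (M - N) i ∈ a := fun i =>
    mem_of_orthogonal ha hb hab (hA.orthogonal_of_mul_eq_zero (funext fun j => congr_fun₂ h0 i j))
  have h := gram_eq_zero ha hmem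
  have hmap : (M - N).map s = M.map s - N.map s := by
    ext
    simp
  rw [hmap, Matrix.transpose_sub, Matrix.sub_mul, Matrix.mul_sub, Matrix.mul_sub,
    gram_eq_zero hb hM, gram_eq_zero hc hN, zero_sub, sub_zero] at h
  exact (neg_eq_of_add_eq_zero_right (by rw [← neg_eq_zero, ← h]; abel)).symm

end


/-- Theorem 1(c): for even `d > 2`, a partial spread `Y` of the Hermitian polar space
`H(2d-1, q²)`, `q = pᵗ`, satisfies `|Y| ≤ (p^(2d-1) - p·(p^(2d-2) - 1)/(p + 1))ᵗ + 1`. -/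
theorem partial_spread_hermitian_bound (p t d : ℕ) (hp : p.Prime) (ht : 1 ≤ t)
    (hd : 2 < d) (hdeven : Even d)
    (F : Type) [Field F] [Fintype F] (hF : Fintype.card F = (p ^ t) ^ 2)
    (Y : Finset (Submodule F (Fin (2 * d) → F)))
    (hgen : ∀ W ∈ Y, Module.finrank F W = d ∧
      ∀ x ∈ W, ∀ y ∈ W, ∑ i, x i * y i ^ (p ^ t) = 0)
    (hspread : ∀ a ∈ Y, ∀ b ∈ Y, a ≠ b → a ⊓ b = ⊥) :
    Y.card ≤ (p ^ (2 * d - 1) - p * ((p ^ (2 * d - 2) - 1) / (p + 1))) ^ t + 1 := by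
  classical
  have : Fact p.Prime := ⟨hp⟩
  have : CharP F p := charP_of_card_eq_prime_pow (f := t * 2) (by rw [hF, pow_mul])
  have : Nonempty (Fin d) := ⟨⟨0, by omega⟩⟩
  have hpt : 1 < p ^ t := Nat.one_lt_pow (by omega) hp.one_lt
  let s : F →+* F := iterateFrobenius F p t
  have hsx : ∀ x, s x = x ^ p ^ t := iterateFrobenius_def p t
  have hs : ∀ x, s (s x) = x := fun x => by
    rw [hsx, hsx, ← pow_mul, ← sq, ← hF, FiniteField.pow_card]
  have hiso : ∀ a ∈ Y, ∀ x ∈ a, ∀ y ∈ a, x ⬝ᵥ (s ∘ y) = 0 := fun a ha x hx y hy => by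
    simpa only [dotProduct, Function.comp_apply, hsx] using (hgen a ha).2 x hx y hy
  have htop : ∀ a ∈ Y, ∀ b ∈ Y, a ≠ b → a ⊔ b = ⊤ := fun a ha b hb hab => by
    apply Submodule.eq_top_of_finrank_eq
    have h := Submodule.finrank_sup_add_finrank_inf_eq a b
    rw [hspread a ha b hb hab, finrank_bot, (hgen a ha).1, (hgen b hb).1] at h
    rw [Module.finrank_fin_fun]
    omega
  rcases Y.eq_empty_or_nonempty with rfl | ⟨a, ha⟩
  · simp
  choose! B hB using fun b (hb : b ∈ Y) => exists_isRowBasis (hgen b hb).1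
  let U : Submodule F (Fin (2 * d) → F) → Matrix (Fin d) (Fin d) F := fun b =>
    if b = a then 1 else (B b * ((B a).map s)ᵀ)⁻¹
  have hdet : ∀ b ∈ Y, b ≠ a → IsUnit (B b * ((B a).map s)ᵀ).det := fun b hb hba =>
    isUnit_iff_ne_zero.2 <|
      (hB b hb).det_gram_ne_zero (hB a ha) (hiso b hb) (htop a ha b hb hba.symm)
  have hU : ∀ b ∈ Y, (U b).det ≠ 0 := by
    intro b hb
    simp only [U]
    split_ifs with h
    · simp
    · exact (Matrix.isUnit_nonsing_inv_det _ (hdet b hb h)).ne_zero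
  let M := fun b => U b * B b
  have hM : ∀ b ∈ Y, IsRowBasis (M b) b := fun b hb => (hB b hb).mul (hU b hb)
  have hMa : ∀ b ∈ Y, b ≠ a → M b * ((M a).map s)ᵀ = 1 := by
    intro b hb hba
    simp only [M, U, if_neg hba, if_true, Matrix.one_mul]
    rw [Matrix.mul_assoc, Matrix.nonsing_inv_mul _ (hdet b hb hba)]
  have hfix : ∀ b ∈ Y, ∀ c ∈ Y, b ≠ c →
      s (M b * ((M c).map s)ᵀ).det = (M b * ((M c).map s)ᵀ).det := by
    intro b hb c hc hbc
    by_cases hba : b = a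
    · subst hba
      have h : M b * ((M c).map s)ᵀ = 1 := by
        rw [← gram_map_transpose hs, hMa c hc hbc.symm]
        simp [Matrix.map_one]
      simp [h]
    by_cases hca : c = a
    · subst hca
      simp [hMa b hb hba]
    have h := gram_swap_eq_neg (hiso a ha) (hiso b hb) (hiso c hc) (htop a ha b hb (Ne.symm hba))
      (hM a ha) (hM b hb).row_mem (hM c hc).row_mem (hMa b hb hba) (hMa c hc hca)
    have h' := congr_arg Matrix.det (gram_map_transpose (M := M b) (N := M c) hs)
    rw [h, Matrix.det_neg, Matrix.det_transpose, Fintype.card_fin, hdeven.neg_one_pow,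
      one_mul] at h'
    rw [RingHom.map_det]
    exact h'
  obtain ⟨φ, ψ, h⟩ := exists_det_pow_eq_sum (K := F) (m := Fin d) (n := Fin (2 * d)) p t d
    (Fintype.card_fin d)
  have hcard := card_le_succ_card_of_sum_mul_eq (ι := Y) (fun e b => φ e (M b))
    (fun e c => ψ e ((M c).map s)) fun b c => by
      rw [← h]
      split_ifs with hbc
      · rw [hbc, gram_eq_zero (hiso c c.2) (hM c c.2).row_mem, Matrix.det_zero,
          zero_pow (by omega)]
      · have hbc' : (b : Submodule F (Fin (2 * d) → F)) ≠ c := fun h => hbc (Subtype.ext h)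
        have hne := (hM b b.2).det_gram_ne_zero (hM c c.2) (hiso b b.2)
          (htop c c.2 b b.2 hbc'.symm)
        have hq := hfix b b.2 c c.2 hbc'
        rw [hsx, ← Nat.sub_add_cancel hpt.le, pow_succ] at hq
        exact mul_right_cancel₀ hne (hq.trans (one_mul _).symm)
  rw [Fintype.card_coe, Fintype.card_fun, Fintype.card_fin] at hcard
  exact hcard.trans (Nat.add_le_add_right (Nat.pow_le_pow_left
    (card_sum_eq_le p d hp.pos (by omega) (Fintype.card_fin _)) t) 1)
end
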